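/- Picard's theorem: Every regular 1-form ω on X is the pull-back via the normalization map π of a rational 1-form of the type (A dy − B dx)/f_z, where A = 0 and B = 0 are affine equations of two adjoint surfaces of degree d−2 to S. -/

import Mathlib

/-!
# Picard's theorem: the expression of regular 1-forms on a surface

Model: a smooth projective surface `X` is generally projected to a surface `S ⊂ ℙ³` of
degree `d` with ordinary singularities, with affine equation `f = 0` in the coordinates
`(x, y, z) = (X 0, X 1, X 2)`; `π : X → S` is the normalization map.  The function field
`L` of `X` coincides with that of `S`, namely the fraction field of
`K[x,y,z]/(f)`; rational 1-forms on `X` are elements of the module of Kähler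
differentials `Ω[L⁄K]`, and the *regular* 1-forms (the global sections of `Ω¹_X`,
pulled back from rational forms on `S`) are those rational forms which are finite at
every valuation of `L/K` — equivalently, `H⁰(X, Ω¹_X)` is the intersection, over all
valuation subrings `V` of `L` containing `K`, of the images of `Ω[V⁄K] → Ω[L⁄K]`
(by the valuative criterion of properness and Hartogs' extension on the smooth
projective model, this intersection is exactly the space of regular 1-forms).

**Statement (Picard).**  Every regular 1-form `ω` on `X` is (the pull-back via `π` of) a
rational 1-form `(A dy - B dx)/f_z`, where `A = 0` and `B = 0` are adjoint surfaces of
degree `d - 2` to `S`; clearing denominators, `f_z • ω = A • dy - B • dx` in `Ω[L⁄K]`.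
-/

open MvPolynomial

/-- The (affine) double curve of the surface `f = 0`. -/
def doubleCurveSet {K : Type*} [Field K] (f : MvPolynomial (Fin 3) K) : Set (Fin 3 → K) :=
  {p | eval p f = 0 ∧ ∀ i, eval p (pderiv i f) = 0}

/-- `A = 0` is an adjoint surface to `S : f = 0`: it contains the double curve. -/
def IsAdjointTo {K : Type*} [Field K] (f A : MvPolynomial (Fin 3) K) : Prop :=
  ∀ p ∈ doubleCurveSet f, eval p A = 0

/-- The space of regular (everywhere-holomorphic) 1-forms of the function field `L` over
`K`: the intersection, over all valuation subrings `V ⊆ L` containing `K`, of the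
(`K`-spans of the) `V`-submodules of `Ω[L⁄K]` generated by the differentials of elements
of `V`, i.e. of the images of `Ω[V⁄K] → Ω[L⁄K]`.  For `L` the function field of a smooth
projective variety `X` over `K` this is exactly `H⁰(X, Ω¹_X)`. -/
noncomputable def regularDifferentials (K L : Type*) [Field K] [Field L] [Algebra K L] :
    Submodule K (Ω[L⁄K]) :=
  ⨅ (V : ValuationSubring L) (_ : ∀ c : K, algebraMap K L c ∈ V),
    Submodule.span K
      {ω : Ω[L⁄K] | ∃ a b : L, a ∈ V ∧ b ∈ V ∧ ω = a • (KaehlerDifferential.D K L) b}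

section Trace

variable {O F L : Type*} [CommRing O] [IsDomain O] [ValuationRing O] [Field F] [Field L]
  [Algebra O F] [IsFractionRing O F] [Algebra F L] [Algebra O L] [IsScalarTower O F L]

/-- Finitely many integral elements over a valuation ring stabilise a common full lattice. -/
lemma exists_basis_repr_mem_range [FiniteDimensional F L] {a b : L}
    (ha : IsIntegral O a) (hb : IsIntegral O b) :
    ∃ (n : ℕ) (e : Module.Basis (Fin n) F L),
      (∀ i j, e.repr (a * e j) i ∈ (algebraMap O F).range) ∧
      (∀ i j, e.repr (b * e j) i ∈ (algebraMap O F).range) := by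
  classical
  let S := Algebra.adjoin O ({a, b} : Set L)
  have hS : (Subalgebra.toSubmodule S).FG := fg_adjoin_of_finite (Set.toFinite _) (by
    rintro x (rfl | rfl) <;> assumption)
  let u := Module.finBasis F L
  let M : Submodule O L := Subalgebra.toSubmodule S * Submodule.span O (Set.range u)
  have hM : M.FG := hS.mul (Submodule.fg_span (Set.finite_range u))
  have hstab : ∀ c ∈ S, ∀ x ∈ M, c * x ∈ M := by
    intro c hc x hx
    have h := Submodule.mul_mem_mul (show c ∈ Subalgebra.toSubmodule S from hc) hx
    have hSS : Subalgebra.toSubmodule S * Subalgebra.toSubmodule S = Subalgebra.toSubmodule S :=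
      Subalgebra.isIdempotentElem_toSubmodule S
    rwa [← mul_assoc, hSS] at h
  have huM : ∀ i, u i ∈ M := fun i => by
    have := Submodule.mul_mem_mul (show (1 : L) ∈ Subalgebra.toSubmodule S from one_mem S)
      (Submodule.subset_span (R := O) (Set.mem_range_self (f := u) i))
    rwa [one_mul] at this
  have : Module.IsTorsionFree O F := inferInstance
  have : Module.IsTorsionFree O L := Module.IsTorsionFree.trans_faithfulSMul O F L
  have : Module.Flat O M := by
    rw [Module.Flat.flat_iff_torsion_eq_bot_of_isBezout,
      ← Submodule.isTorsionFree_iff_torsion_eq_bot]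
    infer_instance
  have : Module.Finite O M := Module.Finite.iff_fg.mpr hM
  have : Module.Free O M := Module.free_of_flat_of_isLocalRing
  let e0 := Module.finBasis O M
  have hli : LinearIndependent F (fun i => (e0 i : L)) := by
    rw [← LinearIndependent.iff_fractionRing O F]
    exact e0.linearIndependent.map' M.subtype (Submodule.ker_subtype M)
  have hrepr : ∀ x : M, (x : L) = ∑ i, algebraMap O F (e0.repr x i) • (e0 i : L) := by
    intro x
    conv_lhs => rw [← e0.sum_repr x]
    simp only [Submodule.coe_sum, Submodule.coe_smul, algebraMap_smul]
  have hsp : ⊤ ≤ Submodule.span F (Set.range fun i => (e0 i : L)) := by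
    rw [← u.span_eq, Submodule.span_le]
    rintro _ ⟨i, rfl⟩
    have := hrepr ⟨u i, huM i⟩
    simp only at this
    rw [this]
    exact Submodule.sum_mem _ fun j _ =>
      Submodule.smul_mem _ _ (Submodule.subset_span ⟨j, rfl⟩)
  let e := Module.Basis.mk hli hsp
  have key : ∀ x ∈ M, ∀ i, e.repr x i ∈ (algebraMap O F).range := by
    intro x hx i
    refine ⟨e0.repr ⟨x, hx⟩ i, ?_⟩
    have : x = ∑ i, algebraMap O F (e0.repr ⟨x, hx⟩ i) • e i := by
      simpa [e] using hrepr ⟨x, hx⟩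
    conv_rhs => rw [this]
    rw [e.repr_sum_self]
  have he : ∀ j, e j ∈ M := fun j => by simp [e]
  exact ⟨_, e, fun i j => key _ (hstab a (Algebra.subset_adjoin (by simp)) _ (he j)) i,
    fun i j => key _ (hstab b (Algebra.subset_adjoin (by simp)) _ (he j)) i⟩

lemma trace_mul_derivation_mem {K : Type*} [Field K] [Algebra K L] [FiniteDimensional F L]
    (E : Derivation K L L) (I : Submodule O F)
    (hE : ∀ g : O, ∃ i ∈ I, E (algebraMap O L g) = algebraMap F L i) {a b : L}
    (ha : IsIntegral O a) (hb : IsIntegral O b) :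
    Algebra.trace F L (a * E b) ∈ I := by
  classical
  obtain ⟨n, e, hea, heb⟩ := exists_basis_repr_mem_range (F := F) ha hb
  choose A hA using hea
  choose B hB using heb
  choose G hGI hG using fun i j => hE (B i j)
  let N : Matrix (Fin n) (Fin n) F := fun i j => e.repr (E (e j)) i
  have hlb : Algebra.leftMulMatrix e b = Matrix.of fun i j => algebraMap O F (B i j) := by
    ext i j
    rw [Algebra.leftMulMatrix_eq_repr_mul]
    exact (hB i j).symm
  have hla : Algebra.leftMulMatrix e a = Matrix.of fun i j => algebraMap O F (A i j) := by
    ext i j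
    rw [Algebra.leftMulMatrix_eq_repr_mul]
    exact (hA i j).symm
  have hEb : Algebra.leftMulMatrix e (E b) =
      Matrix.of G + N * Algebra.leftMulMatrix e b - Algebra.leftMulMatrix e b * N := by
    ext i j
    rw [Algebra.leftMulMatrix_eq_repr_mul]
    have h1 : E b * e j = E (b * e j) - b * E (e j) := by
      rw [E.leibniz]; simp only [smul_eq_mul]; ring
    have h2 : b * e j = ∑ k, algebraMap O L (B k j) * e k := by
      conv_lhs => rw [← e.sum_repr (b * e j)]
      refine Finset.sum_congr rfl fun k _ => ?_
      rw [← hB k j, Algebra.smul_def, ← IsScalarTower.algebraMap_apply]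
    have h3 : E (b * e j) = ∑ k, (G k j • e k + algebraMap O F (B k j) • E (e k)) := by
      rw [h2, map_sum]
      refine Finset.sum_congr rfl fun k _ => ?_
      rw [E.leibniz, hG k j, smul_eq_mul, smul_eq_mul, Algebra.smul_def, Algebra.smul_def,
        ← IsScalarTower.algebraMap_apply]
      ring
    have h4 : e.repr (b * E (e j)) i = ∑ k, Algebra.leftMulMatrix e b i k * N k j := by
      rw [← Algebra.leftMulMatrix_mulVec_repr e b (E (e j))]; rfl
    have h5 : e.repr (∑ k, G k j • e k) i = G i j := by rw [e.repr_sum_self]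
    have h6 : e.repr (∑ k, algebraMap O F (B k j) • E (e k)) i =
        ∑ k, N i k * Algebra.leftMulMatrix e b k j := by
      rw [map_sum, Finsupp.finsetSum_apply]
      refine Finset.sum_congr rfl fun k _ => ?_
      rw [map_smul, Finsupp.smul_apply, smul_eq_mul, mul_comm, hlb]; rfl
    rw [h1, map_sub, h3, Finset.sum_add_distrib, map_add, Finsupp.sub_apply, Finsupp.add_apply,
      h4, h5, h6, Matrix.sub_apply, Matrix.add_apply, Matrix.mul_apply, Matrix.mul_apply,
      Matrix.of_apply]
  have hcomm : Algebra.leftMulMatrix e a * Algebra.leftMulMatrix e b =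
      Algebra.leftMulMatrix e b * Algebra.leftMulMatrix e a := by
    rw [← map_mul, ← map_mul, mul_comm]
  have htr : Algebra.trace F L (a * E b) =
      (Algebra.leftMulMatrix e a * Matrix.of G).trace := by
    rw [Algebra.trace_eq_matrix_trace e, map_mul, hEb, mul_sub, mul_add, Matrix.trace_sub,
      Matrix.trace_add, add_sub_assoc, add_eq_left, ← mul_assoc, ← mul_assoc, hcomm,
      Matrix.trace_mul_cycle, ← hcomm, sub_eq_zero, Matrix.trace_mul_cycle]
  rw [htr, hla]
  refine Submodule.sum_mem _ fun i _ => ?_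
  rw [Matrix.diag_apply, Matrix.mul_apply]
  refine Submodule.sum_mem _ fun j _ => ?_
  rw [Matrix.of_apply, Matrix.of_apply, ← Algebra.smul_def]
  exact I.smul_mem _ (hGI j i)
end Trace

section LocalGlobal

lemma exists_mul_mem_or_coeff_mem_nonunits {O L : Type*} [CommRing O] [Field L]
    [Algebra O L] (V : ValuationSubring L)
    {x : L} (hx : x ∈ V) (n : ℕ) :
    ∀ p : Polynomial (integralClosure O L), p.natDegree ≤ n → Polynomial.aeval x p = 0 →
      (∃ s ∈ integralClosure O L, s ∉ V.nonunits ∧ s * x ∈ integralClosure O L) ∨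
        ∀ i, (p.coeff i : L) ∈ V.nonunits := by
  have h0 : (0 : L) ∈ V.nonunits := by
    rw [ValuationSubring.mem_nonunits_iff]; simp
  induction n with
  | zero =>
    intro p hp hpx
    right
    rw [Polynomial.eq_C_of_natDegree_le_zero hp] at hpx ⊢
    rw [Polynomial.aeval_C] at hpx
    intro i
    rw [Polynomial.coeff_C]
    split_ifs
    · rw [show ((p.coeff 0 : integralClosure O L) : L) = 0 from hpx]; exact h0
    · exact h0
  | succ n ih =>
    intro p hp hpx
    by_cases hlt : p.natDegree ≤ n
    · exact ih p hlt hpx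
    have hdeg : p.natDegree = n + 1 := by omega
    set u := p.leadingCoeff with hu
    have hux : (u : L) * x ∈ integralClosure O L := by
      have := isIntegral_leadingCoeff_smul p x (by simpa using hpx)
      rw [Algebra.smul_def] at this
      exact isIntegral_trans (R := O) _ this
    by_cases hun : (u : L) ∈ V.nonunits
    swap
    · exact Or.inl ⟨u, u.2, hun, hux⟩
    let w : integralClosure O L := ⟨u * x, hux⟩
    let p' := p.eraseLead + Polynomial.C w * Polynomial.X ^ n
    have hp'd : p'.natDegree ≤ n := by
      refine (Polynomial.natDegree_add_le _ _).trans (max_le ?_ ?_)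
      · exact p.eraseLead_natDegree_le.trans (by omega)
      · exact Polynomial.natDegree_C_mul_X_pow_le _ _
    have hp'x : Polynomial.aeval x p' = 0 := by
      have h1 : Polynomial.aeval x p = Polynomial.aeval x p.eraseLead +
          (u : L) * x ^ (n + 1) := by
        conv_lhs => rw [← p.eraseLead_add_C_mul_X_pow]
        rw [map_add, map_mul, Polynomial.aeval_C, map_pow, Polynomial.aeval_X, hdeg]
        rfl
      have h2 : Polynomial.aeval x p' = Polynomial.aeval x p.eraseLead +
          ((u : L) * x) * x ^ n := by
        simp only [p', map_add, map_mul, Polynomial.aeval_C, map_pow, Polynomial.aeval_X]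
        rfl
      rw [h2, ← hpx, h1]; ring
    refine (ih p' hp'd hp'x).imp_right fun h i => ?_
    have hwn : (w : L) ∈ V.nonunits := by
      have hx' : V.valuation x ≤ 1 := (V.valuation_le_one_iff x).mpr hx
      rw [ValuationSubring.mem_nonunits_iff] at hun ⊢
      change V.valuation ((u : L) * x) < 1
      rw [map_mul]
      exact mul_lt_one_of_lt_of_le hun hx'
    by_cases hi : i = n + 1
    · rw [hi, ← hdeg]; exact hun
    have hco : (p.coeff i : L) = (p'.coeff i : L) - if i = n then (w : L) else 0 := by
      simp only [p', Polynomial.coeff_add, Polynomial.coeff_C_mul_X_pow,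
        Polynomial.eraseLead_coeff, hdeg, hi, if_false]
      split_ifs <;> simp
    rw [hco, ValuationSubring.mem_nonunits_iff]
    refine (Valuation.map_sub _ _ _).trans_lt (max_lt (h i) ?_)
    split_ifs
    · exact hwn
    · exact h0

/-- The additive group generated by the forms `a • D b` with `a`, `b` integral over `O`. -/
noncomputable def integralDifferentials (O K L : Type*) [CommRing O] [Field K] [Field L]
    [Algebra O L] [Algebra K L] : AddSubgroup (Ω[L⁄K]) :=
  AddSubgroup.closure {ω | ∃ a ∈ integralClosure O L, ∃ b ∈ integralClosure O L,
    ω = a • KaehlerDifferential.D K L b}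

lemma smul_mem_integralDifferentials {O K L : Type*} [CommRing O] [Field K] [Field L]
    [Algebra O L] [Algebra K L] {r : L}
    (hr : r ∈ integralClosure O L) {ω : Ω[L⁄K]} (hω : ω ∈ integralDifferentials O K L) :
    r • ω ∈ integralDifferentials O K L := by
  induction hω using AddSubgroup.closure_induction with
  | mem x hx =>
    obtain ⟨a, ha, b, hb, rfl⟩ := hx
    exact AddSubgroup.subset_closure ⟨r * a, mul_mem hr ha, b, hb, by rw [mul_smul]⟩
  | zero => rw [smul_zero]; exact zero_mem _
  | add x y _ _ hx hy => rw [smul_add]; exact add_mem hx hy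
  | neg x _ hx => rw [smul_neg]; exact neg_mem hx

variable {O F L : Type*} [CommRing O] [IsDomain O] [ValuationRing O] [Field F] [Field L]
  [Algebra O F] [IsFractionRing O F] [Algebra F L] [Algebra O L] [IsScalarTower O F L]

lemma exists_forall_dvd_of_nonempty {ι : Type*} (s : Finset ι) (hs : s.Nonempty) (c : ι → O) :
    ∃ i ∈ s, ∀ j ∈ s, c i ∣ c j := by
  classical
  induction hs using Finset.Nonempty.cons_induction with
  | singleton a => exact ⟨a, by simp, by simp⟩
  | cons a s ha hs ih =>
    obtain ⟨i, hi, h⟩ := ih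
    rcases ValuationRing.dvd_total (c a) (c i) with h1 | h1
    · exact ⟨a, by simp, fun j hj => by
        rcases Finset.mem_cons.mp hj with rfl | hj
        · exact dvd_rfl
        · exact h1.trans (h j hj)⟩
    · exact ⟨i, by simp [hi], fun j hj => by
        rcases Finset.mem_cons.mp hj with rfl | hj
        · exact h1
        · exact h j hj⟩

/-- The integral closure of a valuation ring in an algebraic extension localises to
valuation rings. -/
lemma exists_mul_mem_integralClosure [Algebra.IsAlgebraic F L] (V : ValuationSubring L)
    {x : L} (hx : x ∈ V) :
    ∃ s ∈ integralClosure O L, s ∉ V.nonunits ∧ s * x ∈ integralClosure O L := by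
  have : Module.IsTorsionFree O L := Module.IsTorsionFree.trans_faithfulSMul O F L
  have hxa : IsAlgebraic O x :=
    (IsFractionRing.isAlgebraic_iff O F L).mpr (Algebra.IsAlgebraic.isAlgebraic x)
  obtain ⟨p, hp0, hpx⟩ := hxa
  obtain ⟨i, hi, hdvd⟩ := exists_forall_dvd_of_nonempty p.support
    (Polynomial.support_nonempty.mpr hp0) p.coeff
  have hci : p.coeff i ≠ 0 := Polynomial.mem_support_iff.mp hi
  obtain ⟨q, hq⟩ : Polynomial.C (p.coeff i) ∣ p := by
    rw [Polynomial.C_dvd_iff_dvd_coeff]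
    intro j
    by_cases hj : j ∈ p.support
    · exact hdvd j hj
    · rw [Polynomial.notMem_support_iff.mp hj]; exact dvd_zero _
  have hqi : q.coeff i = 1 := by
    have := congr_arg (fun r => Polynomial.coeff r i) hq
    simp only [Polynomial.coeff_C_mul] at this
    exact (mul_eq_left₀ hci).mp this.symm
  have hqx : Polynomial.aeval x q = 0 := by
    rw [hq, map_mul, Polynomial.aeval_C, mul_eq_zero] at hpx
    refine hpx.resolve_left fun h => hci ?_
    exact FaithfulSMul.algebraMap_injective O L (h.trans (map_zero _).symm)
  refine (exists_mul_mem_or_coeff_mem_nonunits (O := O) V hx _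
    (q.map (algebraMap O (integralClosure O L))) le_rfl
    (by rwa [Polynomial.aeval_map_algebraMap])).resolve_right fun h => ?_
  have := h i
  rw [Polynomial.coeff_map, hqi, map_one, ValuationSubring.mem_nonunits_iff] at this
  simp at this

theorem regularDifferentials_le_integralDifferentials {K : Type*} [Field K] [Algebra K L]
    [Algebra.IsAlgebraic F L] (hK : ∀ c : K, algebraMap K L c ∈ integralClosure O L)
    {ω : Ω[L⁄K]} (hω : ω ∈ regularDifferentials K L) :
    ω ∈ integralDifferentials O K L := by
  let A : Subring L := (integralClosure O L).toSubring
  let J : Ideal A :=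
    { carrier := {r | (r : L) • ω ∈ integralDifferentials O K L}
      add_mem' := fun {a b} ha hb => by
        rw [Set.mem_ofPred_eq, Subring.coe_add, add_smul]; exact add_mem ha hb
      zero_mem' := by
        rw [Set.mem_ofPred_eq, Subring.coe_zero, zero_smul]; exact zero_mem _
      smul_mem' := fun c x hx => by
        rw [Set.mem_ofPred_eq, smul_eq_mul, Subring.coe_mul, mul_smul]
        exact smul_mem_integralDifferentials c.2 hx }
  suffices J = ⊤ by
    have h1 : (1 : A) ∈ J := this ▸ Submodule.mem_top
    have h2 : ((1 : A) : L) • ω ∈ integralDifferentials O K L := h1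
    rwa [Subring.coe_one, one_smul] at h2
  by_contra hJ
  obtain ⟨V, hAV, hJV⟩ := Ideal.image_subset_nonunits_valuationSubring J hJ
  have hV : ∀ r ∈ integralClosure O L, r ∈ V := fun r hr => hAV hr
  have hωV := (Submodule.mem_iInf _).mp ((Submodule.mem_iInf _).mp hω V) fun c => hV _ (hK c)
  have hmul : ∀ s t : L, s ∈ integralClosure O L → t ∈ integralClosure O L →
      s ∉ V.nonunits → t ∉ V.nonunits → s * t ∉ V.nonunits := by
    intro s t hs ht
    simp only [ValuationSubring.mem_nonunits_iff, not_lt, map_mul]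
    exact one_le_mul
  obtain ⟨s, hs, hsV, hsω⟩ : ∃ s ∈ integralClosure O L, s ∉ V.nonunits ∧
      s • ω ∈ integralDifferentials O K L := by
    clear_value J
    clear hω
    induction hωV using Submodule.span_induction with
    | mem x hx =>
      obtain ⟨a, b, ha, hb, rfl⟩ := hx
      obtain ⟨s, hs, hsV, hsa⟩ := exists_mul_mem_integralClosure (O := O) (F := F) V ha
      obtain ⟨t, ht, htV, htb⟩ := exists_mul_mem_integralClosure (O := O) (F := F) V hb
      refine ⟨s * (t * t), mul_mem hs (mul_mem ht ht),
        hmul _ _ hs (mul_mem ht ht) hsV (hmul _ _ ht ht htV htV), ?_⟩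
      have : (s * (t * t)) • a • KaehlerDifferential.D K L b =
          (s * a * t) • KaehlerDifferential.D K L (t * b) -
            (s * a * (t * b)) • KaehlerDifferential.D K L t := by
        rw [Derivation.leibniz, smul_add, smul_smul, smul_smul, smul_smul]
        rw [show s * a * t * b = s * a * (t * b) by ring, add_sub_cancel_right]
        congr 1; ring
      rw [this]
      exact sub_mem (AddSubgroup.subset_closure ⟨_, mul_mem hsa ht, _, htb, rfl⟩)
        (AddSubgroup.subset_closure ⟨_, mul_mem hsa htb, _, ht, rfl⟩)
    | zero =>
      refine ⟨1, one_mem _, ?_, by rw [smul_zero]; exact zero_mem _⟩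
      rw [ValuationSubring.mem_nonunits_iff]; simp
    | add x y _ _ hx hy =>
      obtain ⟨s, hs, hsV, hsx⟩ := hx
      obtain ⟨t, ht, htV, hty⟩ := hy
      refine ⟨s * t, mul_mem hs ht, hmul _ _ hs ht hsV htV, ?_⟩
      rw [smul_add]
      refine add_mem ?_ ?_
      · rw [mul_comm, mul_smul]; exact smul_mem_integralDifferentials ht hsx
      · rw [mul_smul]; exact smul_mem_integralDifferentials hs hty
    | smul k x _ hx =>
      obtain ⟨s, hs, hsV, hsx⟩ := hx
      refine ⟨s, hs, hsV, ?_⟩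
      rw [← algebraMap_smul L k x, smul_comm]
      exact smul_mem_integralDifferentials (hK k) hsx
  have : (s : L) ∈ V.nonunits := hJV ⟨⟨s, hs⟩, hsω, rfl⟩
  exact hsV this

theorem trace_mul_liftKaehlerDifferential_mem {K : Type*} [Field K] [Algebra K L]
    [FiniteDimensional F L] (hK : ∀ c : K, algebraMap K L c ∈ integralClosure O L)
    (E : Derivation K L L) (I : Submodule O F)
    (hE : ∀ g : O, ∃ i ∈ I, E (algebraMap O L g) = algebraMap F L i)
    {ω : Ω[L⁄K]} (hω : ω ∈ regularDifferentials K L) {s : L} (hs : IsIntegral O s) :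
    Algebra.trace F L (s * E.liftKaehlerDifferential ω) ∈ I := by
  have h := smul_mem_integralDifferentials hs
    (regularDifferentials_le_integralDifferentials (O := O) (F := F) hK hω)
  rw [← smul_eq_mul, ← map_smul]
  generalize s • ω = ν at h ⊢
  induction h using AddSubgroup.closure_induction with
  | mem x hx =>
    obtain ⟨a, ha, b, hb, rfl⟩ := hx
    rw [map_smul, Derivation.liftKaehlerDifferential_comp_D, smul_eq_mul]
    exact trace_mul_derivation_mem E I hE ha hb
  | zero => rw [map_zero, map_zero]; exact zero_mem _
  | add x y _ _ hx hy => rw [map_add, map_add]; exact add_mem hx hy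
  | neg x _ hx => rw [map_neg, map_neg]; exact neg_mem hx

end LocalGlobal

section ValuationRings

lemma exists_valuationSubring_of_rel {P F : Type*} [CommRing P] [IsDomain P] [Field F]
    [Algebra P F] [IsFractionRing P F] (r : P → P → Prop) (htotal : ∀ a b, r a b ∨ r b a)
    (htrans : ∀ {a b c}, r a b → r b c → r a c) (hadd : ∀ {a b c}, r a c → r b c → r (a + b) c)
    (hmul : ∀ {a b}, r a b → ∀ c, r (a * c) (b * c))
    (hcancel : ∀ {a b c}, c ≠ 0 → r (a * c) (b * c) → r a b)
    (hzero : ∀ {a}, r a 0 → a = 0) :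
    ∃ O : ValuationSubring F, ∀ a b : P, b ≠ 0 →
      (algebraMap P F a / algebraMap P F b ∈ O ↔ r a b) := by
  let : ValuativeRel P :=
    { vle := r
      vle_total := htotal
      vle_trans := htrans
      vle_add := hadd
      mul_vle_mul_left := hmul
      vle_mul_cancel := fun {_ _ c} hc => hcancel fun h => hc <| by
        rw [h]; exact (htotal 0 0).elim id id
      not_vle_one_zero := fun h => one_ne_zero (hzero h)
      vle_mul_comm := fun {x y} => by rw [mul_comm]; exact (htotal _ _).elim id id }
  let v := ValuativeRel.valuation P
  have hv : ∀ a b, v a ≤ v b ↔ r a b := fun a b =>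
    (Valuation.Compatible.vle_iff_le (v := v) a b).symm
  have hv0 : ∀ b, b ≠ 0 → v b ≠ 0 := fun b hb h => hb <| hzero <| by
    rw [← hv, h]; exact zero_le
  have hS : nonZeroDivisors P ≤ v.supp.primeCompl := fun b hb h =>
    hv0 b (nonZeroDivisors.ne_zero hb) h
  refine ⟨(v.extendToLocalization hS F).valuationSubring, fun a b hb => ?_⟩
  rw [Valuation.mem_valuationSubring_iff, map_div₀, Valuation.extendToLocalization_apply_map_apply,
    Valuation.extendToLocalization_apply_map_apply, div_le_one₀ (zero_lt_iff.mpr (hv0 b hb)), hv]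

variable {K : Type*} [Field K] {σ : Type*}

lemma MvPolynomial.totalDegree_pderiv_lt (i : σ) {p : MvPolynomial σ K} (hp : pderiv i p ≠ 0) :
    (pderiv i p).totalDegree < p.totalDegree := by
  obtain ⟨m, hm, hmd⟩ := Finset.exists_mem_eq_sup (pderiv i p).support
    (support_nonempty.mpr hp) (fun s => s.sum fun _ e => e)
  rw [totalDegree, hmd]
  have hc : coeff (m + Finsupp.single i 1) p ≠ 0 := by
    intro h
    rw [mem_support_iff, coeff_pderiv, h, zero_mul] at hm
    exact hm rfl
  have := le_totalDegree (mem_support_iff.mpr hc)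
  rw [Finsupp.sum_add_index' (by simp) (by simp), Finsupp.sum_single_index rfl] at this
  lia

lemma lexOrder_le_lexOrder_X_mul_pderiv [LinearOrder σ] [WellFoundedGT σ] (i : σ)
    (p : MvPolynomial σ K) : (p : MvPowerSeries σ K).lexOrder ≤
      ((X i * pderiv i p : MvPolynomial σ K) : MvPowerSeries σ K).lexOrder := by
  rw [MvPowerSeries.le_lexOrder_iff]
  intro e he
  have h := MvPowerSeries.coeff_eq_zero_of_lt_lexOrder he
  rw [coeff_coe] at h ⊢
  rw [coeff_X_mul', coeff_pderiv]
  split_ifs with hi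
  · rw [Finsupp.sub_single_one_add (Finsupp.mem_support_iff.mp hi), add_tsub_cancel_right, h,
      zero_mul]
  · rfl

lemma exists_lexOrder_lt_lexOrder_sub_C_mul [LinearOrder σ] [WellFoundedGT σ]
    {a b : MvPolynomial σ K} (hb : b ≠ 0)
    (hab : (b : MvPowerSeries σ K).lexOrder ≤ (a : MvPowerSeries σ K).lexOrder) :
    ∃ c : K, (b : MvPowerSeries σ K).lexOrder <
      ((a - C c * b : MvPolynomial σ K) : MvPowerSeries σ K).lexOrder := by
  obtain ⟨e, he⟩ := MvPowerSeries.exists_finsupp_eq_lexOrder_of_ne_zero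
    (coe_eq_zero_iff.not.mpr hb)
  have hbe := MvPowerSeries.coeff_ne_zero_of_lexOrder he.symm
  rw [coeff_coe] at hbe
  refine ⟨coeff e a / coeff e b, lt_of_not_ge fun hle => ?_⟩
  have h0 : ((a - C (coeff e a / coeff e b) * b : MvPolynomial σ K) : MvPowerSeries σ K) ≠ 0 := by
    intro h
    rw [h, MvPowerSeries.lexOrder_zero, top_le_iff, he] at hle
    exact WithTop.coe_ne_top hle
  obtain ⟨e', he'⟩ := MvPowerSeries.exists_finsupp_eq_lexOrder_of_ne_zero h0
  have hne := MvPowerSeries.coeff_ne_zero_of_lexOrder he'.symm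
  rw [coeff_coe, coeff_sub, coeff_C_mul] at hne
  rw [he'] at hle
  rcases hle.lt_or_eq with hlt | heq
  · have h1 := MvPowerSeries.coeff_eq_zero_of_lt_lexOrder hlt
    have h2 := MvPowerSeries.coeff_eq_zero_of_lt_lexOrder (hlt.trans_le hab)
    rw [coeff_coe] at h1 h2
    rw [h1, h2] at hne
    simp at hne
  · rw [he, WithTop.coe_inj, toLex_inj] at heq
    subst heq
    rw [div_mul_cancel₀ _ hbe, sub_self] at hne
    exact hne rfl

variable {F : Type*} [Field F]

/-- The valuation ring of a prime element. -/
lemma exists_valuationSubring_prime {P : Type*} [CommRing P] [IsDomain P] [WfDvdMonoid P]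
    [Algebra P F] [IsFractionRing P F] {π : P} (hπ : Prime π) :
    ∃ O : ValuationSubring F, ∀ a b : P, b ≠ 0 →
      (algebraMap P F a / algebraMap P F b ∈ O ↔ emultiplicity π b ≤ emultiplicity π a) := by
  refine exists_valuationSubring_of_rel (fun a b => emultiplicity π b ≤ emultiplicity π a)
    (fun a b => le_total _ _) (fun h h' => h'.trans h)
    (fun h h' => (le_min h h').trans min_le_emultiplicity_add)
    (fun h c => ?_) (fun {a b c} hc h => ?_) (fun {a} h => ?_)
  · rw [emultiplicity_mul hπ, emultiplicity_mul hπ]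
    gcongr
  · rw [emultiplicity_mul hπ, emultiplicity_mul hπ] at h
    have := FiniteMultiplicity.of_prime_left hπ hc
    rwa [ENat.add_le_add_iff_right (emultiplicity_lt_top.mpr this).ne] at h
  · by_contra ha
    rw [emultiplicity_zero, top_le_iff] at h
    exact (emultiplicity_lt_top.mpr (FiniteMultiplicity.of_prime_left hπ ha)).ne h

variable [Algebra (MvPolynomial σ K) F] [IsFractionRing (MvPolynomial σ K) F]

/-- The valuation ring of the divisor at infinity. -/
lemma exists_valuationSubring_totalDegree :
    ∃ O : ValuationSubring F, ∀ a b : MvPolynomial σ K, b ≠ 0 →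
      (algebraMap _ F a / algebraMap _ F b ∈ O ↔ a = 0 ∨ a.totalDegree ≤ b.totalDegree) := by
  obtain ⟨O, hO⟩ := exists_valuationSubring_of_rel (F := F)
    (fun a b : MvPolynomial σ K => a = 0 ∨ (b ≠ 0 ∧ a.totalDegree ≤ b.totalDegree))
    (fun a b => by
      by_cases ha : a = 0
      · exact Or.inl (Or.inl ha)
      by_cases hb : b = 0
      · exact Or.inr (Or.inl hb)
      simp [ha, hb, le_total])
    (fun {a b c} h h' => by
      rcases h with h | ⟨h1, h2⟩
      · exact Or.inl h
      rcases h' with h' | ⟨h3, h4⟩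
      · exact absurd h' h1
      · exact Or.inr ⟨h3, h2.trans h4⟩)
    (fun {a b c} h h' => by
      rcases h with rfl | ⟨h1, h2⟩
      · rwa [zero_add]
      rcases h' with rfl | ⟨h3, h4⟩
      · rw [add_zero]; exact Or.inr ⟨h1, h2⟩
      · exact Or.inr ⟨h3, (totalDegree_add _ _).trans (max_le h2 h4)⟩)
    (fun {a b} h c => by
      rcases h with rfl | ⟨h1, h2⟩
      · simp
      by_cases ha : a = 0
      · simp [ha]
      by_cases hc : c = 0
      · simp [hc]
      · right
        rw [totalDegree_mul_of_isDomain ha hc, totalDegree_mul_of_isDomain h1 hc]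
        exact ⟨mul_ne_zero h1 hc, by gcongr⟩)
    (fun {a b c} hc h => by
      rcases h with h | ⟨h1, h2⟩
      · exact Or.inl ((mul_eq_zero.mp h).resolve_right hc)
      by_cases ha : a = 0
      · exact Or.inl ha
      rw [totalDegree_mul_of_isDomain ha hc,
        totalDegree_mul_of_isDomain (left_ne_zero_of_mul h1) hc] at h2
      exact Or.inr ⟨left_ne_zero_of_mul h1, by lia⟩)
    (fun {a} h => h.resolve_right fun h' => h'.1 rfl)
  exact ⟨O, fun a b hb => by rw [hO a b hb]; simp [hb]⟩

/-- A rank two valuation ring centred at the origin. -/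
lemma exists_valuationSubring_lexOrder [LinearOrder σ] [WellFoundedGT σ] :
    ∃ O : ValuationSubring F, ∀ a b : MvPolynomial σ K, b ≠ 0 →
      (algebraMap _ F a / algebraMap _ F b ∈ O ↔
        (b : MvPowerSeries σ K).lexOrder ≤ (a : MvPowerSeries σ K).lexOrder) := by
  refine exists_valuationSubring_of_rel (fun a b : MvPolynomial σ K =>
      (b : MvPowerSeries σ K).lexOrder ≤ (a : MvPowerSeries σ K).lexOrder)
    (fun a b => le_total _ _) (fun h h' => h'.trans h) (fun h h' => ?_)
    (fun h c => ?_) (fun {a b c} hc h => ?_) (fun {a} h => ?_)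
  · rw [coe_add]; exact (le_min h h').trans MvPowerSeries.min_lexOrder_le
  · rw [coe_mul, coe_mul, MvPowerSeries.lexOrder_mul, MvPowerSeries.lexOrder_mul]
    exact add_le_add_left h _
  · rw [coe_mul, coe_mul, MvPowerSeries.lexOrder_mul, MvPowerSeries.lexOrder_mul] at h
    refine (WithTop.add_le_add_iff_right ?_).mp h
    rwa [Ne, MvPowerSeries.lexOrder_eq_top_iff_eq_zero, coe_eq_zero_iff]
  · rwa [coe_zero, MvPowerSeries.lexOrder_zero, top_le_iff,
      MvPowerSeries.lexOrder_eq_top_iff_eq_zero, coe_eq_zero_iff] at h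

end ValuationRings

section Plane

lemma ValuationSubring.exists_eq_algebraMap_div {K F : Type*} [Field K] [Field F]
    [Algebra (MvPolynomial (Fin 2) K) F] [IsFractionRing (MvPolynomial (Fin 2) K) F]
    (O : ValuationSubring F) (g : O) :
    ∃ a b : MvPolynomial (Fin 2) K, b ≠ 0 ∧
      algebraMap (MvPolynomial (Fin 2) K) F a / algebraMap _ F b ∈ O ∧
      (g : F) = algebraMap _ F a / algebraMap _ F b := by
  obtain ⟨a, b, hb, h⟩ := IsFractionRing.div_surjective (A := MvPolynomial (Fin 2) K) (g : F)
  exact ⟨a, b, nonZeroDivisors.ne_zero hb, by rw [h]; exact g.2, h.symm⟩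

variable {K F L : Type*} [Field K] [Field F] [Field L] [Algebra K L]
  [Algebra (MvPolynomial (Fin 2) K) F] [Algebra (MvPolynomial (Fin 2) K) L] [Algebra F L]
  [IsScalarTower (MvPolynomial (Fin 2) K) F L]

lemma derivation_algebraMap_div {E : Derivation K L L}
    (hE : ∀ p : MvPolynomial (Fin 2) K, E (algebraMap _ L p) = algebraMap _ L (pderiv 1 p))
    (a b : MvPolynomial (Fin 2) K) :
    E (algebraMap F L (algebraMap _ F a / algebraMap _ F b)) =
      algebraMap F L (algebraMap _ F (b * pderiv 1 a - a * pderiv 1 b) /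
        algebraMap _ F (b ^ 2)) := by
  rw [map_div₀, ← IsScalarTower.algebraMap_apply, ← IsScalarTower.algebraMap_apply,
    Derivation.leibniz_div, hE, hE, map_div₀, ← IsScalarTower.algebraMap_apply,
    ← IsScalarTower.algebraMap_apply]
  simp only [smul_eq_mul, map_sub, map_mul, map_pow]
  ring

variable [IsScalarTower K (MvPolynomial (Fin 2) K) L]

lemma algebraMap_mem_integralClosure_of_mem {O : ValuationSubring F}
    (hO : ∀ c : K, algebraMap (MvPolynomial (Fin 2) K) F (C c) ∈ O) (c : K) :
    algebraMap K L c ∈ integralClosure O L := by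
  have : algebraMap K L c = algebraMap O L ⟨algebraMap _ F (C c), hO _⟩ := by
    rw [IsScalarTower.algebraMap_apply K (MvPolynomial (Fin 2) K) L,
      IsScalarTower.algebraMap_apply (MvPolynomial (Fin 2) K) F L,
      IsScalarTower.algebraMap_apply O F L]
    rfl
  rw [this]
  exact isIntegral_algebraMap

variable [IsFractionRing (MvPolynomial (Fin 2) K) F] [FiniteDimensional F L]

/-- Traces of integral multiples of a contracted regular form are polynomial. -/
lemma trace_mem_range_of_isIntegral {E : Derivation K L L}
    (hE : ∀ p : MvPolynomial (Fin 2) K, E (algebraMap _ L p) = algebraMap _ L (pderiv 1 p))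
    {ω : Ω[L⁄K]} (hω : ω ∈ regularDifferentials K L) {s : L}
    (hs : IsIntegral (MvPolynomial (Fin 2) K) s) :
    ∃ p : MvPolynomial (Fin 2) K,
      algebraMap _ F p = Algebra.trace F L (s * E.liftKaehlerDifferential ω) := by
  set t := Algebra.trace F L (s * E.liftKaehlerDifferential ω)
  have key : ∀ {π : MvPolynomial (Fin 2) K}, Prime π → ∀ a b : MvPolynomial (Fin 2) K, b ≠ 0 →
      t = algebraMap _ F a / algebraMap _ F b → emultiplicity π b ≤ emultiplicity π a := by
    intro π hπ a b hb hab
    obtain ⟨O, hO⟩ := exists_valuationSubring_prime (F := F) hπ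
    have hP : ∀ p : MvPolynomial (Fin 2) K, algebraMap _ F p ∈ O := fun p => by
      have := (hO p 1 one_ne_zero).mpr (by
        rw [emultiplicity_of_one_right hπ.not_isUnit]; exact zero_le)
      rwa [map_one, div_one] at this
    have hsO : IsIntegral O s := by
      obtain ⟨q, hq, hqs⟩ := hs
      refine ⟨q.map (((algebraMap _ F).codRestrict O.toSubring hP)), hq.map _, ?_⟩
      rw [Polynomial.eval₂_map, ← hqs]
      congr 1
      ext <;> simp [IsScalarTower.algebraMap_apply (MvPolynomial (Fin 2) K) F L] <;> rfl
    have hEO : ∀ g : O, ∃ i ∈ (1 : Submodule O F), E (algebraMap O L g) = algebraMap F L i := by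
      intro g
      obtain ⟨a, b, hb, hab, hg⟩ := O.exists_eq_algebraMap_div (K := K) g
      rw [hO a b hb] at hab
      have hbf := FiniteMultiplicity.of_prime_left hπ hb
      obtain ⟨b', hbb', hb'⟩ := hbf.exists_eq_pow_mul_and_not_dvd
      obtain ⟨a', ha'⟩ : π ^ multiplicity π b ∣ a := pow_dvd_of_le_emultiplicity (by
        rwa [← hbf.emultiplicity_eq_multiplicity])
      have hb0 : b' ≠ 0 := fun h => hb' (h ▸ dvd_zero _)
      have hgb : (g : F) = algebraMap _ F a' / algebraMap _ F b' := by
        generalize multiplicity π b = n at hbb' ha'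
        rw [hg, ha', hbb', map_mul, map_mul, mul_div_mul_left]
        rw [Ne, FaithfulSMul.algebraMap_eq_zero_iff]
        exact pow_ne_zero _ hπ.ne_zero
      refine ⟨_, ?_, by
        rw [IsScalarTower.algebraMap_apply O F L,
          show algebraMap O F g = _ from hgb, derivation_algebraMap_div hE]⟩
      rw [Submodule.mem_one]
      refine ⟨⟨_, (hO _ _ (pow_ne_zero 2 hb0)).mpr ?_⟩, rfl⟩
      rw [emultiplicity_eq_zero.mpr fun h => hb' (hπ.dvd_of_dvd_pow h)]
      exact zero_le
    have ht := trace_mul_liftKaehlerDifferential_mem (F := F)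
      (algebraMap_mem_integralClosure_of_mem fun c => hP (C c)) E 1 hEO hω hsO
    obtain ⟨g, hg⟩ := Submodule.mem_one.mp ht
    rw [← hO a b hb, ← hab, ← show algebraMap O F g = t from hg]
    exact g.2
  obtain ⟨a, b, hrel, hab⟩ := IsFractionRing.exists_reduced_fraction (A := MvPolynomial (Fin 2) K) t
  have hb0 := nonZeroDivisors.ne_zero b.2
  rw [IsFractionRing.mk'_eq_div] at hab
  by_cases hbu : IsUnit (b : MvPolynomial (Fin 2) K)
  · obtain ⟨u, hu⟩ := hbu.exists_right_inv
    refine ⟨a * u, ?_⟩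
    rw [← hab, eq_div_iff (by rwa [Ne, FaithfulSMul.algebraMap_eq_zero_iff]), ← map_mul, mul_assoc,
      mul_comm u, hu, mul_one]
  · obtain ⟨π, hπ, hπb⟩ := WfDvdMonoid.exists_irreducible_factor hbu hb0
    have h := key hπ.prime a b hb0 hab.symm
    refine absurd (hrel ?_ hπb) hπ.not_isUnit
    exact dvd_of_emultiplicity_pos ((emultiplicity_pos_of_dvd hπb).trans_le h)

/-- The behaviour at infinity of traces of integral multiples of a contracted regular form. -/
lemma exists_valuationSubring_trace_infinity {E : Derivation K L L}
    (hE : ∀ p : MvPolynomial (Fin 2) K, E (algebraMap _ L p) = algebraMap _ L (pderiv 1 p))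
    {ω : Ω[L⁄K]} (hω : ω ∈ regularDifferentials K L) :
    ∃ O : ValuationSubring F,
      (∀ a b : MvPolynomial (Fin 2) K, b ≠ 0 →
        (algebraMap _ F a / algebraMap _ F b ∈ O ↔ a = 0 ∨ a.totalDegree ≤ b.totalDegree)) ∧
      ∀ s : L, IsIntegral O s → algebraMap (MvPolynomial (Fin 2) K) F (X 0) *
        Algebra.trace F L (s * E.liftKaehlerDifferential ω) ∈ O := by
  obtain ⟨O, hO⟩ := exists_valuationSubring_totalDegree (F := F) (K := K) (σ := Fin 2)
  refine ⟨O, hO, fun s hs => ?_⟩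
  have hC : ∀ c : K, algebraMap (MvPolynomial (Fin 2) K) F (C c) ∈ O := fun c => by
    have := (hO (C c) 1 one_ne_zero).mpr (by simp)
    rwa [map_one, div_one] at this
  have hEO : ∀ g : O, ∃ i ∈ (1 : Submodule O F).comap
      (LinearMap.mulLeft O (algebraMap (MvPolynomial (Fin 2) K) F (X 0))),
      E (algebraMap O L g) = algebraMap F L i := by
    intro g
    obtain ⟨a, b, hb, hab, hg⟩ := O.exists_eq_algebraMap_div (K := K) g
    rw [hO a b hb] at hab
    refine ⟨_, ?_, by
      rw [IsScalarTower.algebraMap_apply O F L, show algebraMap O F g = _ from hg,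
        derivation_algebraMap_div hE]⟩
    rw [Submodule.mem_comap, LinearMap.mulLeft_apply, ← mul_div_assoc, ← map_mul,
      Submodule.mem_one]
    refine ⟨⟨_, (hO _ _ (pow_ne_zero 2 hb)).mpr ?_⟩, rfl⟩
    rw [mul_eq_zero, or_iff_right (X_ne_zero _)]
    rcases hab with rfl | hab
    · simp
    by_cases h0 : b * pderiv 1 a - a * pderiv 1 b = 0
    · exact Or.inl h0
    right
    refine (totalDegree_mul _ _).trans ?_
    rw [totalDegree_X, pow_two, totalDegree_mul_of_isDomain hb hb]
    have h1 : (b * pderiv 1 a - a * pderiv 1 b).totalDegree + 1 ≤ b.totalDegree + b.totalDegree := by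
      have h2 : ∀ p q : MvPolynomial (Fin 2) K, p * pderiv 1 q ≠ 0 →
          (p * pderiv 1 q).totalDegree + 1 ≤ p.totalDegree + q.totalDegree := by
        intro p q hpq
        have := totalDegree_pderiv_lt 1 (right_ne_zero_of_mul hpq)
        rw [totalDegree_mul_of_isDomain (left_ne_zero_of_mul hpq) (right_ne_zero_of_mul hpq)]
        lia
      by_cases h3 : b * pderiv 1 a = 0
      · rw [h3, zero_sub] at h0 ⊢
        rw [totalDegree_neg]
        have := h2 a b (neg_ne_zero.mp h0)
        lia
      by_cases h4 : a * pderiv 1 b = 0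
      · rw [h4, sub_zero] at h0 ⊢
        have := h2 b a h3
        lia
      · have := totalDegree_sub (b * pderiv 1 a) (a * pderiv 1 b)
        have := h2 b a h3
        have := h2 a b h4
        lia
    lia
  have ht := trace_mul_liftKaehlerDifferential_mem (F := F)
    (algebraMap_mem_integralClosure_of_mem hC) E _ hEO hω hs
  obtain ⟨g, hg⟩ := Submodule.mem_one.mp (Submodule.mem_comap.mp ht)
  rw [← LinearMap.mulLeft_apply (R := O), ← hg]
  exact g.2

/-- The behaviour at the origin of traces of integral multiples of a contracted regular form. -/
lemma exists_valuationSubring_trace_origin {E : Derivation K L L}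
    (hE : ∀ p : MvPolynomial (Fin 2) K, E (algebraMap _ L p) = algebraMap _ L (pderiv 1 p))
    {ω : Ω[L⁄K]} (hω : ω ∈ regularDifferentials K L) :
    ∃ O : ValuationSubring F,
      (∀ p : MvPolynomial (Fin 2) K, algebraMap _ F p ∈ O) ∧
      algebraMap (MvPolynomial (Fin 2) K) F (X 0) / algebraMap (MvPolynomial (Fin 2) K) F (X 1 ^ 2) ∈ O ∧
      (∀ p : MvPolynomial (Fin 2) K, algebraMap _ F p ∈ O.nonunits → constantCoeff p = 0) ∧
      ∀ s : L, IsIntegral O s → algebraMap (MvPolynomial (Fin 2) K) F (X 1) *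
        Algebra.trace F L (s * E.liftKaehlerDifferential ω) ∈ O.nonunits := by
  obtain ⟨O, hO⟩ := exists_valuationSubring_lexOrder (F := F) (K := K) (σ := Fin 2)
  set w : MvPolynomial (Fin 2) K → WithTop (Lex (Fin 2 →₀ ℕ)) :=
    fun p => (p : MvPowerSeries (Fin 2) K).lexOrder with hw
  have hwmul : ∀ p q, w (p * q) = w p + w q := fun p q => by
    simp only [hw, coe_mul, MvPowerSeries.lexOrder_mul]
  have hwcoeff : ∀ p e, coeff e p ≠ 0 → w p ≤ toLex e := fun p e h =>
    MvPowerSeries.lexOrder_le_of_coeff_ne_zero (by rwa [coeff_coe])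
  have hwmin : ∀ p (e : Lex (Fin 2 →₀ ℕ)), (∀ e', toLex e' < e → coeff e' p = 0) → e ≤ w p :=
    fun p e h => MvPowerSeries.le_lexOrder_iff.mpr fun e' he' => by
      rw [coeff_coe]; exact h e' (WithTop.coe_lt_coe.mp he')
  have hw0 : ∀ p, 0 ≤ w p := fun p => hwmin p 0 fun e' he' => absurd he' (by simp)
  have hwtop : ∀ p, p ≠ 0 → w p ≠ ⊤ := fun p hp h => hp <| by
    rwa [hw, MvPowerSeries.lexOrder_eq_top_iff_eq_zero, coe_eq_zero_iff] at h
  have hw1 : w 1 = 0 := le_antisymm (hwcoeff 1 0 (by simp)) (hw0 1)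
  have hP : ∀ p : MvPolynomial (Fin 2) K, algebraMap _ F p ∈ O := fun p => by
    have := (hO p 1 one_ne_zero).mpr (by change w 1 ≤ w p; rw [hw1]; exact hw0 p)
    rwa [map_one, div_one] at this
  have hnon : ∀ a b : MvPolynomial (Fin 2) K, w b < w a → algebraMap _ F a / algebraMap _ F b ∈ O.nonunits := by
    intro a b hab
    rw [ValuationSubring.mem_nonunits_iff]
    by_cases ha : a = 0
    · simp [ha]
    by_contra h
    have : algebraMap _ F b / algebraMap _ F a ∈ O := by
      rw [← ValuationSubring.valuation_le_one_iff, ← inv_div, map_inv₀]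
      exact inv_le_one_of_one_le₀ (not_lt.mp h)
    exact hab.not_ge ((hO _ _ ha).mp this)
  refine ⟨O, hP, ?_, fun p hp => ?_, fun s hs => ?_⟩
  · rw [hO _ _ (pow_ne_zero 2 (X_ne_zero _))]
    refine (hwcoeff (X 1 ^ 2) (Finsupp.single 1 2) (by simp [coeff_X_pow])).trans
      (hwmin (X 0) _ fun e he => ?_)
    rw [coeff_X, if_neg]
    rintro rfl
    obtain ⟨j, hj, hlt⟩ := Finsupp.Lex.lt_iff.mp he
    fin_cases j
    · simp at hlt
    · simpa using hj 0 (by simp)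
  · by_contra h
    have hwp : w p ≤ 0 := hwcoeff p 0 h
    have := (hO 1 p (by rintro rfl; simp at h)).mpr (by change w p ≤ w 1; rwa [hw1])
    have hp0 : algebraMap (MvPolynomial (Fin 2) K) F p ≠ 0 := by
      rw [Ne, FaithfulSMul.algebraMap_eq_zero_iff]; rintro rfl; simp at h
    rw [map_one, one_div, ← ValuationSubring.valuation_le_one_iff, map_inv₀] at this
    rw [ValuationSubring.mem_nonunits_iff] at hp
    have hv := O.valuation.ne_zero_iff.mpr hp0
    exact (one_lt_inv₀ (zero_lt_iff.mpr hv) |>.mpr hp).not_ge this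
  have hEO : ∀ g : O, ∃ i ∈ (Submodule.map (Algebra.linearMap O F) (IsLocalRing.maximalIdeal O)).comap
      (LinearMap.mulLeft O (algebraMap (MvPolynomial (Fin 2) K) F (X 1))),
      E (algebraMap O L g) = algebraMap F L i := by
    intro g
    obtain ⟨a, b, hb, hab, hg⟩ := O.exists_eq_algebraMap_div (K := K) g
    rw [hO a b hb] at hab
    obtain ⟨c, hc⟩ := exists_lexOrder_lt_lexOrder_sub_C_mul hb hab
    refine ⟨_, ?_, by
      rw [IsScalarTower.algebraMap_apply O F L, show algebraMap O F g = _ from hg,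
        derivation_algebraMap_div hE]⟩
    rw [Submodule.mem_comap, LinearMap.mulLeft_apply, ← mul_div_assoc, ← map_mul]
    have hm := hnon (X 1 * (b * pderiv 1 a - a * pderiv 1 b)) (b ^ 2) (by
      set a' := a - C c * b with ha'
      have : X 1 * (b * pderiv 1 a - a * pderiv 1 b) =
          b * (X 1 * pderiv 1 a') + -a' * (X 1 * pderiv 1 b) := by
        rw [ha', map_sub, pderiv_C_mul]; ring
      have h1 := lexOrder_le_lexOrder_X_mul_pderiv 1 a'
      have h2 := lexOrder_le_lexOrder_X_mul_pderiv 1 b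
      have hneg : w (-a') = w a' := by
        rw [show -a' = C (-1) * a' by simp, hwmul, le_antisymm (hwcoeff (C (-1)) 0 (by simp))
          (hw0 _)]
        exact zero_add _
      rw [this, pow_two, hwmul]
      refine lt_of_lt_of_le (lt_min ?_ ?_) (show min (w _) (w _) ≤ w (_ + _) by
        simp only [hw, coe_add]; exact MvPowerSeries.min_lexOrder_le)
      · rw [hwmul]
        exact WithTop.add_lt_add_left (hwtop b hb) (hc.trans_le h1)
      · rw [hwmul, hneg]
        exact (WithTop.add_lt_add_right (hwtop b hb) hc).trans_le (add_le_add_right h2 _))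
    exact ⟨⟨_, O.nonunits_subset hm⟩, O.coe_mem_nonunits_iff.mp hm, rfl⟩
  have ht := trace_mul_liftKaehlerDifferential_mem (F := F)
    (algebraMap_mem_integralClosure_of_mem fun c => hP (C c)) E _ hEO hω hs
  obtain ⟨g, hgm, hg⟩ := Submodule.mem_comap.mp ht
  rw [← LinearMap.mulLeft_apply (R := O), ← hg]
  exact O.coe_mem_nonunits_iff.mpr hgm

end Plane

section Core

lemma ValuationSubring.isIntegral_of_coeff_mem {F L : Type*} [Field F] [Field L] [Algebra F L]
    (O : ValuationSubring F) {s : L} {q : Polynomial F} (hq : q.Monic) (hO : ∀ i, q.coeff i ∈ O)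
    (hs : Polynomial.aeval s q = 0) : IsIntegral O s := by
  have hl : q ∈ Polynomial.lifts (algebraMap O F) := by
    rw [Polynomial.lifts_iff_coeff_lifts]
    exact fun i => ⟨⟨_, hO i⟩, rfl⟩
  obtain ⟨q', hq', -, hm⟩ := Polynomial.lifts_and_natDegree_eq_and_monic hl hq
  refine ⟨q', hm, ?_⟩
  rw [← Polynomial.aeval_def, ← hs, ← hq', Polynomial.aeval_map_algebraMap]

lemma ValuationSubring.isIntegral_algebraMap_of_mem {F L : Type*} [Field F] [Field L] [Algebra F L]
    (O : ValuationSubring F) {g : F} (hg : g ∈ O) : IsIntegral O (algebraMap F L g) :=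
  isIntegral_algebraMap (R := O) (A := L) (x := ⟨g, hg⟩)

variable {K F L : Type*} [Field K] [Field F] [Field L] [Algebra K L]
  [Algebra (MvPolynomial (Fin 2) K) F] [IsFractionRing (MvPolynomial (Fin 2) K) F]
  [Algebra (MvPolynomial (Fin 2) K) L] [Algebra F L]
  [IsScalarTower (MvPolynomial (Fin 2) K) F L] [IsScalarTower K (MvPolynomial (Fin 2) K) L]
  [FiniteDimensional F L]

/-- Contracting a regular form against a derivation that is `∂/∂y` on the plane gives an element
of the complementary module of the normalization, in a degree bounded by the adjoint condition at
infinity. -/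
lemma exists_totalDegree_le_of_mem_regularDifferentials [Algebra.IsSeparable F L]
    (pb : PowerBasis F L) {φ : Polynomial (MvPolynomial (Fin 2) K)} (hφ : φ.Monic)
    (hmin : minpoly F pb.gen = φ.map (algebraMap _ F))
    (hdeg : ∀ i ≤ φ.natDegree, (φ.coeff i).totalDegree + i ≤ φ.natDegree)
    {E : Derivation K L L}
    (hE : ∀ p : MvPolynomial (Fin 2) K, E (algebraMap _ L p) = algebraMap _ L (pderiv 1 p))
    (θ : MvPolynomial (Fin 3) K →ₐ[K] L) (hθ0 : θ (X 0) = pb.gen)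
    (hθ : ∀ p : MvPolynomial (Fin 2) K, θ (rename Fin.succ p) = algebraMap _ L p)
    {ω : Ω[L⁄K]} (hω : ω ∈ regularDifferentials K L) :
    ∃ A : MvPolynomial (Fin 3) K, A.totalDegree ≤ φ.natDegree - 2 ∧
      θ A = Polynomial.aeval pb.gen φ.derivative * E.liftKaehlerDifferential ω := by
  set ζ := pb.gen with hζ
  set η := E.liftKaehlerDifferential ω with hη
  set d := φ.natDegree with hd
  have hdim : pb.dim = d := by
    rw [← pb.natDegree_minpoly, hmin, Polynomial.natDegree_map_eq_of_injective
      (FaithfulSMul.algebraMap_injective _ _)]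
  have hζφ : Polynomial.aeval ζ φ = 0 := by
    rw [← Polynomial.aeval_map_algebraMap F, ← hmin, minpoly.aeval]
  have hζint : IsIntegral (MvPolynomial (Fin 2) K) ζ := ⟨φ, hφ, hζφ⟩
  obtain ⟨O, hO, hOtr⟩ := exists_valuationSubring_trace_infinity (F := F) hE hω
  have hx0 : algebraMap (MvPolynomial (Fin 2) K) F (X 0) ≠ 0 := by
    rw [Ne, FaithfulSMul.algebraMap_eq_zero_iff]; exact X_ne_zero _
  have hζO : IsIntegral O (algebraMap F L (algebraMap (MvPolynomial (Fin 2) K) F (X 0))⁻¹ * ζ) := by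
    refine O.isIntegral_of_coeff_mem (q := (minpoly F ζ).scaleRoots (algebraMap _ F (X 0))⁻¹)
      ((Polynomial.monic_scaleRoots_iff _).mpr (minpoly.monic pb.isIntegral_gen)) (fun i => ?_)
      (Polynomial.scaleRoots_aeval_eq_zero (minpoly.aeval _ _))
    rw [Polynomial.coeff_scaleRoots, hmin, Polynomial.coeff_map, hφ.natDegree_map, inv_pow,
      ← div_eq_mul_inv, ← map_pow, hO _ _ (pow_ne_zero _ (X_ne_zero _)), totalDegree_X_pow]
    by_cases hi : i ≤ d
    · have := hdeg i hi
      exact Or.inr (by lia)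
    · exact Or.inl (Polynomial.coeff_eq_zero_of_natDegree_lt (not_le.mp hi))
  have hτ : ∀ i : ℕ, ∃ p : MvPolynomial (Fin 2) K, (p = 0 ∨ p.totalDegree + 1 ≤ i) ∧
      algebraMap _ F p = Algebra.trace F L (η * ζ ^ i) := by
    intro i
    obtain ⟨p, hp⟩ := trace_mem_range_of_isIntegral (F := F) hE hω (hζint.pow i)
    rw [mul_comm] at hp
    refine ⟨p, ?_, hp⟩
    refine or_iff_not_imp_left.mpr fun hp0 => ?_
    have hsmul (c : F) (w : L) :
        Algebra.trace F L (algebraMap F L c * w) = c * Algebra.trace F L w := by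
      rw [← Algebra.smul_def, map_smul, smul_eq_mul]
    have h := hOtr _ (hζO.pow i)
    rw [mul_pow, mul_assoc, mul_comm (ζ ^ i), ← map_pow, hsmul, ← hη, ← hp, inv_pow,
      mul_left_comm, ← map_pow, ← map_mul, ← div_eq_inv_mul,
      hO _ _ (pow_ne_zero _ (X_ne_zero _)), mul_eq_zero, or_iff_right (X_ne_zero _),
      or_iff_right hp0, totalDegree_X_pow] at h
    rwa [totalDegree_mul_of_isDomain (X_ne_zero _) hp0, totalDegree_X, add_comm] at h
  choose τ hτd hτ using hτ
  have hB : ∀ k i : ℕ, i + k + 1 = d → ∃ B : MvPolynomial (Fin 3) K, B.totalDegree ≤ k ∧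
      θ B = (minpolyDiv F ζ).coeff i := by
    intro k
    have hm := minpolyDiv_monic pb.isIntegral_gen
    have hn := natDegree_minpolyDiv_succ pb.isIntegral_gen
    rw [pb.natDegree_minpoly, hdim] at hn
    induction k with
    | zero =>
      intro i hi
      refine ⟨1, by simp, ?_⟩
      rw [map_one, ← hm.coeff_natDegree]
      congr 1
      lia
    | succ k ih =>
      intro i hi
      obtain ⟨B, hBd, hB⟩ := ih (i + 1) (by lia)
      refine ⟨rename Fin.succ (φ.coeff (i + 1)) + X 0 * B, ?_, ?_⟩
      · refine (totalDegree_add _ _).trans (max_le ?_ ?_)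
        · have := hdeg (i + 1) (by lia)
          have := totalDegree_rename_le Fin.succ (φ.coeff (i + 1))
          lia
        · have := totalDegree_mul (X 0) B
          rw [totalDegree_X] at this
          lia
      · rw [coeff_minpolyDiv, map_add, hθ, map_mul, hθ0, hB, hmin, Polynomial.coeff_map,
          ← IsScalarTower.algebraMap_apply]
        ring
  choose! B hBd hB using hB
  refine ⟨∑ i : Fin pb.dim, rename Fin.succ (τ i) * B (d - i - 1) i, ?_, ?_⟩
  · refine totalDegree_finsetSum_le fun i _ => ?_
    have hi : (i : ℕ) < d := hdim ▸ i.2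
    rcases hτd i with h | h
    · simp [h]
    · have h1 := totalDegree_mul (rename Fin.succ (τ i)) (B (d - i - 1) i)
      have h2 := hBd (d - i - 1) i (by lia)
      have h3 := totalDegree_rename_le Fin.succ (τ i)
      lia
  · have hsep : Polynomial.aeval ζ (minpoly F ζ).derivative ≠ 0 :=
      (Algebra.IsSeparable.isSeparable F ζ).aeval_derivative_ne_zero (minpoly.aeval _ _)
    have hder : Polynomial.aeval ζ φ.derivative = Polynomial.aeval ζ (minpoly F ζ).derivative := by
      rw [hmin, Polynomial.derivative_map, Polynomial.aeval_map_algebraMap]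
    rw [hder]
    conv_rhs => rw [← pb.basis.traceDual.sum_repr η]
    rw [map_sum, Finset.mul_sum]
    refine Finset.sum_congr rfl fun i _ => ?_
    have hi : (i : ℕ) < d := hdim ▸ i.2
    rw [map_mul, hθ, hB (d - i - 1) i (by lia), Module.Basis.traceDual_repr_apply,
      Module.Basis.traceDual_powerBasis_eq, Algebra.traceForm_apply, pb.basis_eq_pow, ← hτ,
      IsScalarTower.algebraMap_apply _ F L, Algebra.smul_def, mul_left_comm, ← hζ,
      mul_div_cancel₀ _ hsep]

end Core

section Origin

lemma PowerBasis.trace_aeval_div_derivative {F L : Type*} [Field F] [Field L] [Algebra F L]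
    [FiniteDimensional F L] [Algebra.IsSeparable F L] (pb : PowerBasis F L) {h : Polynomial F}
    (hh : h.natDegree < pb.dim) :
    Algebra.trace F L
      (Polynomial.aeval pb.gen h / Polynomial.aeval pb.gen (minpoly F pb.gen).derivative) =
      h.coeff (pb.dim - 1) := by
  have hd : pb.dim - 1 < pb.dim := by lia
  have hdual : pb.basis.traceDual ⟨pb.dim - 1, hd⟩ =
      (Polynomial.aeval pb.gen (minpoly F pb.gen).derivative)⁻¹ := by
    have hn := natDegree_minpolyDiv_succ pb.isIntegral_gen
    have hm := minpolyDiv_monic pb.isIntegral_gen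
    rw [pb.natDegree_minpoly] at hn
    rw [Module.Basis.traceDual_powerBasis_eq]
    have : (minpolyDiv F pb.gen).coeff (pb.dim - 1) = 1 := by
      rw [← hm.coeff_natDegree]
      congr 1
      lia
    rw [this, one_div]
  rw [div_eq_mul_inv, ← hdual, Polynomial.aeval_eq_sum_range' hh, Finset.sum_range, Finset.sum_mul,
    map_sum]
  have key (i : Fin pb.dim) : Algebra.trace F L
      (h.coeff i • pb.gen ^ (i : ℕ) * pb.basis.traceDual ⟨pb.dim - 1, hd⟩) =
      if i = ⟨pb.dim - 1, hd⟩ then h.coeff i else 0 := by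
    rw [smul_mul_assoc, map_smul, ← pb.basis_eq_pow, Module.Basis.trace_mul_traceDual]
    split_ifs <;> simp
  rw [Finset.sum_congr rfl fun i _ => key i, Finset.sum_ite_eq' Finset.univ]
  simp

lemma ValuationSubring.div_X_mem {K F : Type*} [Field K] [Field F]
    [Algebra (MvPolynomial (Fin 2) K) F] [IsFractionRing (MvPolynomial (Fin 2) K) F]
    {O : ValuationSubring F} (hO : ∀ p : MvPolynomial (Fin 2) K, algebraMap _ F p ∈ O)
    (hx : algebraMap (MvPolynomial (Fin 2) K) F (X 0) /
      algebraMap (MvPolynomial (Fin 2) K) F (X 1 ^ 2) ∈ O)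
    {p : MvPolynomial (Fin 2) K} (hp : constantCoeff p = 0)
    (hp1 : coeff (Finsupp.single 1 1) p = 0) :
    algebraMap _ F p / algebraMap (MvPolynomial (Fin 2) K) F (X 1 ^ 2) ∈ O := by
  have hy : algebraMap (MvPolynomial (Fin 2) K) F (X 1 ^ 2) ≠ 0 := by
    rw [Ne, FaithfulSMul.algebraMap_eq_zero_iff]; exact pow_ne_zero _ (X_ne_zero _)
  rw [p.as_sum, map_sum, Finset.sum_div]
  refine sum_mem fun m hm => ?_
  rw [mem_support_iff] at hm
  have h0 : m ≠ 0 := by rintro rfl; exact hm hp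
  have h1 : m ≠ Finsupp.single 1 1 := by rintro rfl; exact hm hp1
  by_cases h : m 0 = 0
  · have hm1 : Finsupp.single 1 2 ≤ m := by
      rw [Finsupp.single_le_iff]
      by_contra! hlt
      have : m 1 = 0 ∨ m 1 = 1 := by lia
      rcases this with h' | h'
      · exact h0 (by ext i; fin_cases i <;> simp [h, h'])
      · exact h1 (by ext i; fin_cases i <;> simp [h, h'])
    have : monomial m (coeff m p) = X 1 ^ 2 * monomial (m - Finsupp.single 1 2) (coeff m p) := by
      rw [X_pow_eq_monomial, monomial_mul, one_mul, add_tsub_cancel_of_le hm1]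
    rw [this, map_mul, mul_div_cancel_left₀ _ hy]
    exact hO _
  · have hm1 : Finsupp.single 0 1 ≤ m := by
      rw [Finsupp.single_le_iff]; lia
    have : monomial m (coeff m p) = X 0 * monomial (m - Finsupp.single 0 1) (coeff m p) := by
      rw [X, monomial_mul, one_mul, add_tsub_cancel_of_le hm1]
    rw [this, map_mul, mul_div_right_comm]
    exact O.mul_mem _ _ hx (hO _)

variable {K F L : Type*} [Field K] [Field F] [Field L] [Algebra K L]
  [Algebra (MvPolynomial (Fin 2) K) F] [IsFractionRing (MvPolynomial (Fin 2) K) F]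
  [Algebra (MvPolynomial (Fin 2) K) L] [Algebra F L]
  [IsScalarTower (MvPolynomial (Fin 2) K) F L] [IsScalarTower K (MvPolynomial (Fin 2) K) L]
  [FiniteDimensional F L]

lemma aeval_finSuccEquiv (θ : MvPolynomial (Fin 3) K →ₐ[K] L)
    (hθ : ∀ p : MvPolynomial (Fin 2) K, θ (rename Fin.succ p) = algebraMap _ L p)
    (A : MvPolynomial (Fin 3) K) :
    Polynomial.aeval (θ (X 0)) (finSuccEquiv K 2 A) = θ A := by
  suffices h : ((Polynomial.aeval (R := MvPolynomial (Fin 2) K) (θ (X 0))).restrictScalars K).comp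
      (finSuccEquiv K 2).toAlgHom = θ from DFunLike.congr_fun h A
  refine algHom_ext fun i => ?_
  refine Fin.cases ?_ (fun i => ?_) i
  · simp [finSuccEquiv_X_zero]
  · have := hθ (X i)
    simp_all [finSuccEquiv_X_succ]

open Polynomial in
lemma Polynomial.coeff_X_mul_mul_modByMonic {R : Type*} [CommRing R] [Nontrivial R]
    {q : R[X]} (hq : q.Monic) (a : R[X]) :
    ((X * q * a) %ₘ (X ^ 2 * q)).coeff (q.natDegree + 1) = a.coeff 0 := by
  have hm : (X ^ 2 * q).Monic := (monic_X_pow 2).mul hq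
  have hX : (X * q).Monic := monic_X.mul hq
  have hn : (X * q).natDegree = q.natDegree + 1 := by
    rw [monic_X.natDegree_mul hq, natDegree_X, add_comm]
  have h := div_modByMonic_unique (f := X * q * a) (g := X ^ 2 * q) a.divX (C (a.coeff 0) * (X * q))
    hm ⟨by
      conv_rhs => rw [← divX_mul_X_add a]
      ring, by
      refine (degree_mul_le _ _).trans_lt ((add_le_add_left degree_C_le _).trans_lt ?_)
      rw [zero_add, degree_eq_natDegree hm.ne_zero, degree_eq_natDegree hX.ne_zero, hn,
        (monic_X_pow 2).natDegree_mul hq, natDegree_X_pow]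
      exact_mod_cast (by lia : q.natDegree + 1 < 2 + q.natDegree)⟩
  rw [h.2, coeff_C_mul, ← hn, hX.coeff_natDegree, mul_one]

lemma constantCoeff_eq_zero_of_mem_regularDifferentials [Algebra.IsSeparable F L]
    (pb : PowerBasis F L) {φ : Polynomial (MvPolynomial (Fin 2) K)} (hφ : φ.Monic)
    (hmin : minpoly F pb.gen = φ.map (algebraMap _ F))
    (h0 : constantCoeff (φ.coeff 0) = 0) (h1 : constantCoeff (φ.coeff 1) = 0)
    (h01 : coeff (Finsupp.single 1 1) (φ.coeff 0) = 0)
    {E : Derivation K L L}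
    (hE : ∀ p : MvPolynomial (Fin 2) K, E (algebraMap _ L p) = algebraMap _ L (pderiv 1 p))
    (θ : MvPolynomial (Fin 3) K →ₐ[K] L) (hθ0 : θ (X 0) = pb.gen)
    (hθ : ∀ p : MvPolynomial (Fin 2) K, θ (rename Fin.succ p) = algebraMap _ L p)
    {ω : Ω[L⁄K]} (hω : ω ∈ regularDifferentials K L) {A : MvPolynomial (Fin 3) K}
    (hA : θ A = Polynomial.aeval pb.gen φ.derivative * E.liftKaehlerDifferential ω) :
    constantCoeff A = 0 := by
  set ζ := pb.gen with hζ
  set η := E.liftKaehlerDifferential ω with hη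
  set d := φ.natDegree with hd
  have hdim : pb.dim = d := by
    rw [← pb.natDegree_minpoly, hmin, Polynomial.natDegree_map_eq_of_injective
      (FaithfulSMul.algebraMap_injective _ _)]
  have hζφ : Polynomial.aeval ζ φ = 0 := by
    rw [← Polynomial.aeval_map_algebraMap F, ← hmin, minpoly.aeval]
  have hsep : Polynomial.aeval ζ (minpoly F ζ).derivative ≠ 0 :=
    (Algebra.IsSeparable.isSeparable F ζ).aeval_derivative_ne_zero (minpoly.aeval _ _)
  have hder : Polynomial.aeval ζ φ.derivative = Polynomial.aeval ζ (minpoly F ζ).derivative := by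
    rw [hmin, Polynomial.derivative_map, Polynomial.aeval_map_algebraMap]
  obtain ⟨q, hq⟩ : Polynomial.X ^ 2 ∣ φ.map constantCoeff := by
    rw [Polynomial.X_pow_dvd_iff]
    intro i hi
    rw [Polynomial.coeff_map]
    interval_cases i
    · exact h0
    · exact h1
  have hqm : q.Monic := ((Polynomial.monic_X_pow 2).of_mul_monic_left (hq ▸ hφ.map _))
  have hqd : d = q.natDegree + 2 := by
    rw [hd, ← hφ.natDegree_map constantCoeff, hq, (Polynomial.monic_X_pow 2).natDegree_mul hqm,
      Polynomial.natDegree_X_pow, add_comm]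
  obtain ⟨O, hO, hxO, hOc, hOtr⟩ := exists_valuationSubring_trace_origin (F := F) hE hω
  set x := algebraMap (MvPolynomial (Fin 2) K) F (X 0) with hx
  set y := algebraMap (MvPolynomial (Fin 2) K) F (X 1) with hy
  have hy0 : y ≠ 0 := by
    rw [hy, Ne, FaithfulSMul.algebraMap_eq_zero_iff]; exact X_ne_zero _
  have hζO : IsIntegral O ζ := O.isIntegral_of_coeff_mem (minpoly.monic pb.isIntegral_gen)
    (fun i => by rw [hmin, Polynomial.coeff_map]; exact hO _) (minpoly.aeval _ _)
  have hOaeval (g : Polynomial (MvPolynomial (Fin 2) K)) :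
      IsIntegral O (Polynomial.aeval ζ g) := by
    rw [Polynomial.aeval_eq_sum_range]
    refine IsIntegral.sum _ fun i _ => ?_
    rw [Algebra.smul_def, IsScalarTower.algebraMap_apply _ F L]
    exact (O.isIntegral_algebraMap_of_mem (hO _)).mul (hζO.pow i)
  -- `ζ q(ζ) / y` is integral over the valuation ring
  set Q := Polynomial.aeval ζ (q.map (C : K →+* MvPolynomial (Fin 2) K)) with hQ
  have hQO : IsIntegral O Q := hOaeval _
  set e := φ - Polynomial.X ^ 2 * q.map (C : K →+* MvPolynomial (Fin 2) K) with he
  have hec (i : ℕ) : constantCoeff (e.coeff i) = 0 := by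
    rw [← Polynomial.coeff_map, he, Polynomial.map_sub, Polynomial.map_mul, hq, Polynomial.map_map,
      Polynomial.map_pow, Polynomial.map_X]
    simp
  have he0 : e.coeff 0 = φ.coeff 0 := by
    simp [he]
  set c := algebraMap F L (algebraMap _ F (e.coeff 0) / y ^ 2) with hc
  set b := algebraMap F L y⁻¹ * Polynomial.aeval ζ e.divX with hb
  have hcO : IsIntegral O c := by
    refine O.isIntegral_algebraMap_of_mem ?_
    rw [hy, ← map_pow]
    exact O.div_X_mem hO hxO (hec 0) (he0 ▸ h01)
  have hbO : IsIntegral O b := by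
    rw [hb, Polynomial.aeval_eq_sum_range, Finset.mul_sum]
    refine IsIntegral.sum _ fun i _ => ?_
    rw [Algebra.smul_def, IsScalarTower.algebraMap_apply (MvPolynomial (Fin 2) K) F L, ← mul_assoc, ← map_mul,
      ← div_eq_inv_mul]
    refine (O.isIntegral_algebraMap_of_mem ?_).mul (hζO.pow i)
    have h := O.div_X_mem hO hxO (p := X 1 * e.divX.coeff i) (by simp) ?_
    · rwa [map_mul, map_pow, ← hy, sq, mul_div_mul_left _ _ hy0] at h
    · rw [coeff_X_mul', if_pos (by simp), tsub_self]
      simpa [constantCoeff_eq] using hec (i + 1)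
  have hrel : ζ ^ 2 * Q + Polynomial.aeval ζ e.divX * ζ +
      algebraMap F L (algebraMap _ F (e.coeff 0)) = 0 := by
    have h := congrArg (Polynomial.aeval ζ) (e.divX_mul_X_add)
    rw [map_add, map_mul, Polynomial.aeval_X, Polynomial.aeval_C,
      IsScalarTower.algebraMap_apply _ F L] at h
    rw [add_assoc, h, he, map_sub, hζφ, map_mul, map_pow, Polynomial.aeval_X]
    ring
  set s := algebraMap F L y⁻¹ * (ζ * Q) with hs
  have hsO : IsIntegral O s := by
    have hss : s ^ 2 + b * s + Q * c = 0 := by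
      have : s ^ 2 + b * s + Q * c = Q * algebraMap F L (y ^ 2)⁻¹ * (ζ ^ 2 * Q +
          Polynomial.aeval ζ e.divX * ζ + algebraMap F L (algebraMap _ F (e.coeff 0))) := by
        simp only [hs, hb, hc, map_div₀, map_inv₀, map_pow]
        ring
      rw [this, hrel, mul_zero]
    refine isIntegral_trans (A := integralClosure O L) s
      ⟨Polynomial.X ^ 2 + Polynomial.C ⟨b, hbO⟩ * Polynomial.X + Polynomial.C ⟨Q * c, hQO.mul hcO⟩,
        by monicity!, ?_⟩
    simpa [Polynomial.eval₂_add] using hss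
  have hval := hOtr s hsO
  set H := Polynomial.X * q.map (C : K →+* MvPolynomial (Fin 2) K) * finSuccEquiv K 2 A with hH
  set p := (H %ₘ φ).coeff (d - 1) with hp
  have htr : y * Algebra.trace F L (s * η) = algebraMap _ F p := by
    have hAζ : Polynomial.aeval ζ (finSuccEquiv K 2 A) = θ A := by
      rw [← hθ0, aeval_finSuccEquiv θ hθ]
    have hsη : y • (s * η) = Polynomial.aeval ζ ((H %ₘ φ).map (algebraMap _ F)) /
        Polynomial.aeval ζ (minpoly F ζ).derivative := by
      rw [Polynomial.aeval_map_algebraMap, Polynomial.aeval_modByMonic_eq_self_of_root hζφ, hH,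
        map_mul, map_mul, hAζ, hA, Polynomial.aeval_X, ← hQ,
        ← hder, eq_div_iff (hder ▸ hsep), Algebra.smul_def, hs]
      have : algebraMap F L y ≠ 0 := by simpa using hy0
      rw [map_inv₀]
      field_simp
    rw [← smul_eq_mul, ← map_smul, hsη, pb.trace_aeval_div_derivative, Polynomial.coeff_map, hdim]
    refine Polynomial.natDegree_map_le.trans_lt ?_
    rw [hdim]
    exact Polynomial.natDegree_modByMonic_lt _ hφ fun h => by
      rw [hd, h, Polynomial.natDegree_one] at hqd; lia
  have hp0 : constantCoeff p = 0 := hOc p (htr ▸ hval)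
  have hp1 : constantCoeff p = constantCoeff A := by
    rw [hp, ← Polynomial.coeff_map, Polynomial.map_modByMonic _ hφ, hq, hH, hqd]
    have : q.natDegree + 2 - 1 = q.natDegree + 1 := by lia
    rw [Polynomial.map_mul, Polynomial.map_mul, Polynomial.map_X, Polynomial.map_map, this]
    have hcC : (constantCoeff : MvPolynomial (Fin 2) K →+* K).comp C = RingHom.id K := by
      ext; simp
    rw [hcC, Polynomial.map_id, Polynomial.coeff_X_mul_mul_modByMonic hqm, Polynomial.coeff_map,
      constantCoeff_eq, constantCoeff_eq, finSuccEquiv_coeff_coeff, Finsupp.cons_zero_zero]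
  rw [← hp1, hp0]

end Origin

section Derivations

lemma Derivation.apply_algHom {K R M σ : Type*} [CommRing K] [CommRing R] [Algebra K R]
    [AddCommGroup M] [Module R M] [Module K M] [IsScalarTower K R M] [Fintype σ]
    (D : Derivation K R M) (ψ : MvPolynomial σ K →ₐ[K] R) (p : MvPolynomial σ K) :
    D (ψ p) = ∑ i, ψ (pderiv i p) • D (ψ (X i)) := by
  classical
  induction p using MvPolynomial.induction_on with
  | C a =>
    have : ψ (C a) = algebraMap K R a := ψ.commutes a
    simp [this]
  | add p q hp hq => simp [hp, hq, add_smul, Finset.sum_add_distrib]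
  | mul_X p i hp =>
    simp only [map_mul, Derivation.leibniz, hp, pderiv_X, smul_eq_mul, map_add, add_smul,
      Finset.sum_add_distrib, Finset.smul_sum, mul_smul, Pi.single_apply, apply_ite ψ, map_one,
      map_zero, ite_smul, one_smul, zero_smul, smul_ite, smul_zero]
    simp

variable {K L : Type*} [Field K] [Field L] [Algebra K L]

lemma Derivation.ext_of_isFractionRing_range {M σ : Type*} [AddCommGroup M] [Module L M]
    [Module K M] [IsScalarTower K L M] [Fintype σ] (θ : MvPolynomial σ K →ₐ[K] L)
    (hθ : IsFractionRing θ.range L) {D₁ D₂ : Derivation K L M}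
    (h : ∀ i, D₁ (θ (X i)) = D₂ (θ (X i))) : D₁ = D₂ := by
  ext x
  obtain ⟨⟨_, a, rfl⟩, ⟨_, b, rfl⟩, -, rfl⟩ := IsFractionRing.div_surjective (A := θ.range) x
  change D₁ (θ a / θ b) = D₂ (θ a / θ b)
  have key (p : MvPolynomial σ K) : D₁ (θ p) = D₂ (θ p) := by
    simp only [Derivation.apply_algHom _ θ p, h]
  rw [Derivation.leibniz_div, Derivation.leibniz_div, key, key]

lemma KaehlerDifferential.linearMap_ext_of_isFractionRing_range {M σ : Type*} [AddCommGroup M]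
    [Module L M] [Module K M] [IsScalarTower K L M] [Fintype σ] (θ : MvPolynomial σ K →ₐ[K] L)
    (hθ : IsFractionRing θ.range L) {u v : Ω[L⁄K] →ₗ[L] M}
    (h : ∀ i, u (KaehlerDifferential.D K L (θ (X i))) = v (KaehlerDifferential.D K L (θ (X i)))) :
    u = v :=
  Derivation.liftKaehlerDifferential_unique _ _ (Derivation.ext_of_isFractionRing_range θ hθ h)

/-- A vector field along an irreducible hypersurface that is tangent to it extends to a derivation
of the function field. -/
lemma exists_derivation_of_sum_pderiv_eq_zero {σ : Type*} [Fintype σ] {f : MvPolynomial σ K}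
    (θ : MvPolynomial σ K →ₐ[K] L)
    (hker : RingHom.ker (θ : MvPolynomial σ K →+* L) = Ideal.span {f})
    (hθ : IsFractionRing θ.range L) (e : σ → L) (he : ∑ i, θ (pderiv i f) * e i = 0) :
    ∃ E : Derivation K L L, ∀ i, E (θ (X i)) = e i := by
  classical
  let ψ : MvPolynomial σ K →ₐ[K] DualNumber L :=
    aeval fun i => TrivSqZeroExt.inl (θ (X i)) + TrivSqZeroExt.inr (e i)
  have hfst (p : MvPolynomial σ K) : (ψ p).fst = θ p := by
    suffices h : (TrivSqZeroExt.fstHom K L L).comp ψ = θ from DFunLike.congr_fun h p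
    ext i
    simp [ψ]
  have hsnd (p : MvPolynomial σ K) : (ψ p).snd = ∑ i, θ (pderiv i p) * e i := by
    induction p using MvPolynomial.induction_on with
    | C a => simp [ψ, TrivSqZeroExt.algebraMap_eq_inl']
    | add p q hp hq => simp [hp, hq, add_mul, Finset.sum_add_distrib]
    | mul_X p i hp =>
      have hX : ψ (X i) = TrivSqZeroExt.inl (θ (X i)) + TrivSqZeroExt.inr (e i) := aeval_X _ _
      simp only [map_mul, TrivSqZeroExt.snd_mul, hp, hfst, hX, Derivation.leibniz, pderiv_X,
        smul_eq_mul, map_add, add_mul, Finset.sum_add_distrib, Pi.single_apply, apply_ite θ,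
        map_zero, ite_mul, mul_ite, zero_mul, mul_zero, mul_one,
        TrivSqZeroExt.snd_add, TrivSqZeroExt.snd_inl, TrivSqZeroExt.snd_inr, zero_add]
      simp [mul_assoc, Finset.mul_sum, mul_comm (∑ i, _) (θ (X i))]
  have hψ : RingHom.ker θ.rangeRestrict ≤ RingHom.ker ψ := by
    intro p hp
    have hp' : p ∈ RingHom.ker (θ : MvPolynomial σ K →+* L) := congrArg Subtype.val hp
    rw [hker, Ideal.mem_span_singleton] at hp'
    obtain ⟨q, rfl⟩ := hp'
    have hf0 : θ f = 0 := by
      have : f ∈ RingHom.ker (θ : MvPolynomial σ K →+* L) :=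
        hker ▸ Ideal.mem_span_singleton_self f
      exact this
    have : ψ f = 0 := TrivSqZeroExt.ext (by simp [hfst, hf0]) (by simp [hsnd, he])
    simp [RingHom.mem_ker, this]
  let g := AlgHom.liftOfSurjective θ.rangeRestrict θ.rangeRestrict_surjective ψ hψ
  have hg (p : MvPolynomial σ K) : g (θ.rangeRestrict p) = ψ p :=
    AlgHom.liftOfSurjective_apply ..
  have hgf (r : θ.range) : (g r).fst = r := by
    obtain ⟨p, rfl⟩ := θ.rangeRestrict_surjective r
    rw [hg, hfst]
    rfl
  have hunit (r : nonZeroDivisors θ.range) : IsUnit (g r) := by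
    rw [TrivSqZeroExt.isUnit_iff_isUnit_fst, hgf, isUnit_iff_ne_zero]
    simp
  let G : L →ₐ[K] DualNumber L := IsLocalization.liftAlgHom (M := nonZeroDivisors θ.range) hunit
  have hG (r : θ.range) : G r = g r := IsLocalization.lift_eq hunit r
  have hGf (x : L) : (G x).fst = x := by
    obtain ⟨a, b, -, rfl⟩ := IsFractionRing.div_surjective (A := θ.range) x
    have h : (TrivSqZeroExt.fstHom K L L).comp G (algebraMap _ L a / algebraMap _ L b) =
        algebraMap _ L a / algebraMap _ L b := by
      rw [map_div₀]
      congr 1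
      · exact (congrArg _ (hG a)).trans (hgf a)
      · exact (congrArg _ (hG b)).trans (hgf b)
    exact h
  refine ⟨Derivation.mk' ((TrivSqZeroExt.sndHom L L).restrictScalars K ∘ₗ G.toLinearMap) ?_, ?_⟩
  · intro a b
    simp [hGf, mul_comm]
  · intro i
    have := congrArg TrivSqZeroExt.snd ((hG (θ.rangeRestrict (X i))).trans (hg _))
    exact this.trans (by simp [ψ])

end Derivations

section MonicModel

lemma MvPolynomial.finSuccEquiv_rename_succ {R : Type*} [CommSemiring R] {n : ℕ}
    (p : MvPolynomial (Fin n) R) :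
    finSuccEquiv R n (rename Fin.succ p) = Polynomial.C p := by
  suffices h : (finSuccEquiv R n).toAlgHom.comp (rename Fin.succ) =
      (Algebra.ofId (MvPolynomial (Fin n) R) (Polynomial (MvPolynomial (Fin n) R))).restrictScalars R
    from DFunLike.congr_fun h p
  ext i : 1
  simp [finSuccEquiv_X_succ]

lemma MvPolynomial.finSuccEquiv_pderiv_zero {R : Type*} [CommRing R] {n : ℕ}
    (p : MvPolynomial (Fin (n + 1)) R) :
    finSuccEquiv R n (pderiv 0 p) = Polynomial.derivative (finSuccEquiv R n p) := by
  refine Polynomial.ext fun i => MvPolynomial.ext _ _ fun m => ?_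
  have hm : Finsupp.cons i m + Finsupp.single 0 1 = Finsupp.cons (i + 1) m := by
    ext j
    refine Fin.cases ?_ (fun j => ?_) j <;> simp
  have hi : ((i : MvPolynomial (Fin n) R) + 1) = C ((i : R) + 1) := by simp
  rw [finSuccEquiv_coeff_coeff, coeff_pderiv, Polynomial.coeff_derivative, hi, mul_comm _ (C _),
    coeff_C_mul,
    finSuccEquiv_coeff_coeff, hm, Finsupp.cons_zero, mul_comm]

lemma MvPolynomial.eval_zero_pderiv {R σ : Type*} [CommRing R] (i : σ) (p : MvPolynomial σ R) :
    eval 0 (pderiv i p) = coeff (Finsupp.single i 1) p := by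
  rw [eval_zero, constantCoeff_eq, coeff_pderiv]
  simp

variable {K L : Type*} [Field K] [Field L] [Algebra K L]

/-- The case of Picard's theorem in which the polynomial is monic of full degree in the
distinguished variable. -/
lemma regularDifferentials_of_coeff_ne_zero {f : MvPolynomial (Fin 3) K} (hf : Irreducible f)
    (θ : MvPolynomial (Fin 3) K →ₐ[K] L)
    (hker : RingHom.ker (θ : MvPolynomial (Fin 3) K →+* L) = Ideal.span {f})
    (hθ : IsFractionRing θ.range L)
    (hc : coeff (Finsupp.single 0 f.totalDegree) f ≠ 0) (hf0 : θ (pderiv 0 f) ≠ 0)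
    {E : Derivation K L L} (hE1 : E (θ (X 1)) = 0) (hE2 : E (θ (X 2)) = θ (pderiv 0 f))
    {ω : Ω[L⁄K]} (hω : ω ∈ regularDifferentials K L) :
    (∃ A : MvPolynomial (Fin 3) K, A.totalDegree ≤ f.totalDegree - 2 ∧
      θ A = E.liftKaehlerDifferential ω) ∧
    (0 ∈ doubleCurveSet f → ∀ A, θ A = E.liftKaehlerDifferential ω → eval 0 A = 0) := by
  set d := f.totalDegree with hd
  set c := coeff (Finsupp.single 0 d) f with hcdef
  set φ := Polynomial.C (C c⁻¹) * finSuccEquiv K 2 f with hφdef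
  have hφcoeff (i : ℕ) : φ.coeff i = C c⁻¹ * (finSuccEquiv K 2 f).coeff i := by
    rw [hφdef, Polynomial.coeff_C_mul]
  have hφdeg (i : ℕ) (hi : φ.coeff i ≠ 0) : (φ.coeff i).totalDegree + i ≤ d := by
    rw [hφcoeff] at hi ⊢
    have := totalDegree_coeff_finSuccEquiv_add_le f i (right_ne_zero_of_mul hi)
    have := totalDegree_mul (C c⁻¹) ((finSuccEquiv K 2 f).coeff i)
    rw [totalDegree_C] at this
    lia
  have hφd : φ.coeff d = 1 := by
    have h : (φ.coeff d).totalDegree = 0 := by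
      by_cases h0 : φ.coeff d = 0
      · rw [h0, totalDegree_zero]
      · have := hφdeg d h0
        lia
    rw [totalDegree_eq_zero_iff_eq_C] at h
    rw [h, hφcoeff, coeff_C_mul, finSuccEquiv_coeff_coeff]
    have : Finsupp.cons d (0 : Fin 2 →₀ ℕ) = Finsupp.single 0 d := by
      ext j
      refine Fin.cases ?_ (fun j => ?_) j <;> simp
    rw [this, inv_mul_cancel₀ hc, C_1]
  have hφle : φ.natDegree ≤ d := Polynomial.natDegree_le_iff_coeff_eq_zero.mpr fun i hi => by
    by_contra h
    have := hφdeg i h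
    lia
  have hφ : φ.Monic := Polynomial.monic_of_natDegree_le_of_coeff_eq_one d hφle hφd
  have hφn : φ.natDegree = d :=
    le_antisymm hφle (Polynomial.le_natDegree_of_ne_zero (by simp [hφd]))
  have hφirr : Irreducible φ := by
    have hu : IsUnit (Polynomial.C (C c⁻¹) : Polynomial (MvPolynomial (Fin 2) K)) :=
      ((isUnit_iff_ne_zero.mpr (inv_ne_zero hc)).map C).map Polynomial.C
    rw [hφdef, irreducible_isUnit_mul hu]
    exact (MulEquiv.irreducible_iff (finSuccEquiv K 2)).mpr hf
  have hd0 : 0 < d := by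
    rw [← hφn]
    exact hφ.natDegree_pos.mpr fun h => hφirr.not_isUnit (h ▸ isUnit_one)
  have hθf : θ f = 0 := by
    have : f ∈ RingHom.ker (θ : MvPolynomial (Fin 3) K →+* L) := hker ▸ Ideal.mem_span_singleton_self f
    exact this
  let _ : Algebra (MvPolynomial (Fin 2) K) L := (θ.comp (rename Fin.succ)).toRingHom.toAlgebra
  have hθsucc (p : MvPolynomial (Fin 2) K) :
    θ (rename Fin.succ p) = algebraMap (MvPolynomial (Fin 2) K) L p := rfl
  have hinj : Function.Injective (algebraMap (MvPolynomial (Fin 2) K) L) := by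
    rw [injective_iff_map_eq_zero]
    intro p hp
    have hmem : rename Fin.succ p ∈ RingHom.ker (θ : MvPolynomial (Fin 3) K →+* L) := hp
    rw [hker, Ideal.mem_span_singleton, ← map_dvd_iff (finSuccEquiv K 2),
      finSuccEquiv_rename_succ] at hmem
    have hdvd : φ ∣ Polynomial.C p := by
      refine dvd_trans ⟨Polynomial.C (C c), ?_⟩ hmem
      rw [hφdef, mul_right_comm, ← Polynomial.C_mul, ← C_mul, inv_mul_cancel₀ hc]
      simp
    by_contra hp0
    have := Polynomial.natDegree_le_of_dvd hdvd (by simpa using hp0)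
    rw [Polynomial.natDegree_C] at this
    lia
  have : FaithfulSMul (MvPolynomial (Fin 2) K) L := (faithfulSMul_iff_algebraMap_injective _ _).mpr hinj
  have : IsScalarTower K (MvPolynomial (Fin 2) K) L := IsScalarTower.of_algebraMap_eq fun a => by
    rw [← hθsucc]; simp [MvPolynomial.algebraMap_eq]
  let F := FractionRing (MvPolynomial (Fin 2) K)
  let _ : Algebra F L := FractionRing.liftAlgebra (MvPolynomial (Fin 2) K) L
  set ζ := θ (X 0) with hζ
  have haeval (A : MvPolynomial (Fin 3) K) : Polynomial.aeval ζ (finSuccEquiv K 2 A) = θ A :=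
    aeval_finSuccEquiv θ hθsucc A
  have haevalC (a : K) (p : Polynomial (MvPolynomial (Fin 2) K)) :
      Polynomial.aeval ζ (Polynomial.C (C a) * p) = algebraMap K L a * Polynomial.aeval ζ p := by
    rw [map_mul, Polynomial.aeval_C, ← MvPolynomial.algebraMap_eq,
      ← IsScalarTower.algebraMap_apply]
  have hζφ : Polynomial.aeval ζ φ = 0 := by
    rw [hφdef, haevalC, haeval, hθf, mul_zero]
  have hζφ' : Polynomial.aeval ζ φ.derivative = algebraMap K L c⁻¹ * θ (pderiv 0 f) := by
    rw [hφdef, Polynomial.derivative_C_mul, haevalC, ← finSuccEquiv_pderiv_zero, haeval]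
  have hcL : algebraMap K L c ≠ 0 := by simpa using hc
  have hφF : Irreducible (φ.map (algebraMap (MvPolynomial (Fin 2) K) F)) :=
    hφ.irreducible_iff_irreducible_map_fraction_map.mp hφirr
  have hmin : minpoly F ζ = φ.map (algebraMap (MvPolynomial (Fin 2) K) F) :=
    (minpoly.eq_of_irreducible_of_monic hφF (by rw [Polynomial.aeval_map_algebraMap, hζφ])
      (hφ.map _)).symm
  have hζint : IsIntegral F ζ :=
    ⟨_, hφ.map _, by rw [← Polynomial.aeval_def, Polynomial.aeval_map_algebraMap, hζφ]⟩
  have hadj : IntermediateField.adjoin F {ζ} = ⊤ := by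
    rw [eq_top_iff]
    rintro x -
    have hmem (A : MvPolynomial (Fin 3) K) : θ A ∈ IntermediateField.adjoin F {ζ} := by
      rw [← haeval, ← Polynomial.aeval_map_algebraMap F]
      exact IntermediateField.algebra_adjoin_le_adjoin F {ζ}
        (Polynomial.aeval_mem_adjoin_singleton _ _)
    obtain ⟨⟨_, a, rfl⟩, ⟨_, b, rfl⟩, -, rfl⟩ := IsFractionRing.div_surjective (A := θ.range) x
    exact div_mem (hmem a) (hmem b)
  have hsep : IsSeparable F ζ := by
    rw [IsSeparable, Polynomial.separable_iff_derivative_ne_zero (minpoly.irreducible hζint)]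
    intro h
    have := congrArg (Polynomial.aeval ζ) h
    rw [hmin, Polynomial.derivative_map, Polynomial.aeval_map_algebraMap, hζφ', map_zero] at this
    simp_all
  have : Algebra.IsSeparable F L := by
    have := (IntermediateField.isSeparable_adjoin_simple_iff_isSeparable F L).mpr hsep
    rw [hadj] at this
    exact AlgEquiv.Algebra.isSeparable IntermediateField.topEquiv
  let pb : PowerBasis F L := PowerBasis.ofAdjoinEqTop' hζint (by
    rw [← IntermediateField.adjoin_simple_toSubalgebra_of_isAlgebraic hζint.isAlgebraic, hadj,
      IntermediateField.top_toSubalgebra])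
  have hpb : pb.gen = ζ := PowerBasis.ofAdjoinEqTop'_gen _ _
  have : FiniteDimensional F L := pb.finite
  let E' : Derivation K L L := (θ (pderiv 0 f))⁻¹ • E
  have hE' (p : MvPolynomial (Fin 2) K) : E' (algebraMap (MvPolynomial (Fin 2) K) L p) =
      algebraMap (MvPolynomial (Fin 2) K) L (pderiv 1 p) := by
    have h := Derivation.apply_algHom E' (θ.comp (rename Fin.succ)) p
    have h1 : E' (θ (X 1)) = 0 := by simp [E', hE1]
    have h2 : E' (θ (X 2)) = 1 := by simp [E', hE2, hf0]
    rw [Fin.sum_univ_two] at h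
    simpa [h1, h2, hθsucc] using h
  have hE'ω : E'.liftKaehlerDifferential ω =
      (θ (pderiv 0 f))⁻¹ * E.liftKaehlerDifferential ω := by
    rw [← smul_eq_mul, ← LinearMap.smul_apply]
    congr 1
    exact Derivation.liftKaehlerDifferential_unique _ _ (by ext; simp [E'])
  have hkey (A : MvPolynomial (Fin 3) K) : θ A = E.liftKaehlerDifferential ω ↔
      θ (C c⁻¹ * A) = Polynomial.aeval pb.gen φ.derivative * E'.liftKaehlerDifferential ω := by
    rw [hpb, hζφ', hE'ω, mul_assoc, mul_inv_cancel_left₀ hf0, map_mul]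
    have : θ (C c⁻¹) = algebraMap K L c⁻¹ := θ.commutes _
    rw [this, mul_right_inj' (by simpa using hc)]
  have hdeg (i : ℕ) (hi : i ≤ φ.natDegree) : (φ.coeff i).totalDegree + i ≤ φ.natDegree := by
    by_cases h : φ.coeff i = 0
    · simpa [h] using hi
    · exact hφn.symm ▸ hφdeg i h
  constructor
  · obtain ⟨A, hA, hAω⟩ := exists_totalDegree_le_of_mem_regularDifferentials pb hφ (hpb ▸ hmin)
      hdeg hE' θ hpb.symm hθsucc hω
    refine ⟨C c * A, ?_, ?_⟩
    · have := totalDegree_mul (C c) A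
      rw [totalDegree_C] at this
      lia
    · rw [hkey, ← mul_assoc, ← C_mul, inv_mul_cancel₀ hc, C_1, one_mul, hAω]
  · rintro ⟨h0, h1⟩ A hA
    rw [eval_zero] at h0 ⊢
    simp_rw [eval_zero_pderiv] at h1
    have hcc := constantCoeff_eq_zero_of_mem_regularDifferentials pb hφ (hpb ▸ hmin)
      ?_ ?_ ?_ hE' θ hpb.symm hθsucc hω ((hkey A).mp hA)
    · simpa [hc] using hcc
    · simpa [hφcoeff, constantCoeff_eq, finSuccEquiv_coeff_coeff] using Or.inr h0
    · have : Finsupp.cons 1 (0 : Fin 2 →₀ ℕ) = Finsupp.single 0 1 := by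
        ext j
        refine Fin.cases ?_ (fun j => ?_) j <;> simp
      rw [hφcoeff, constantCoeff_eq, coeff_C_mul, finSuccEquiv_coeff_coeff, this, h1, mul_zero]
    · have : Finsupp.cons 0 (Finsupp.single (1 : Fin 2) 1) = Finsupp.single 2 1 := by
        ext j
        refine Fin.cases ?_ (fun j => ?_) j
        · simp
        · rw [Finsupp.cons_succ, show (2 : Fin 3) = Fin.succ 1 from rfl,
            Finsupp.single_apply, Finsupp.single_apply]
          simp only [Fin.succ_inj]
      rw [hφcoeff, coeff_C_mul, finSuccEquiv_coeff_coeff, this, h1, mul_zero]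

end MonicModel

section AffineSubstitution

lemma MvPolynomial.totalDegree_aeval_le {R σ τ : Type*} [CommSemiring R]
    {g : σ → MvPolynomial τ R} (hg : ∀ i, (g i).totalDegree ≤ 1) (p : MvPolynomial σ R) :
    (aeval g p).totalDegree ≤ p.totalDegree := by
  rw [aeval_def, eval₂_eq]
  refine totalDegree_finsetSum_le fun m hm => (totalDegree_mul _ _).trans ?_
  rw [algebraMap_eq, totalDegree_C, zero_add]
  refine (totalDegree_finsetProd _ _).trans (le_trans ?_ (le_totalDegree hm))
  exact Finset.sum_le_sum fun i _ => (totalDegree_pow _ _).trans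
    (by simpa using Nat.mul_le_mul_left (m i) (hg i))

lemma MvPolynomial.homogeneousComponent_totalDegree_ne_zero {R σ : Type*} [CommSemiring R]
    {p : MvPolynomial σ R} (hp : p ≠ 0) : homogeneousComponent p.totalDegree p ≠ 0 := by
  obtain ⟨m, hm, hmd⟩ := Finset.exists_mem_eq_sup p.support (support_nonempty.mpr hp)
    fun s => s.sum fun _ e => e
  have hmd : m.degree = p.totalDegree := hmd.symm
  intro h
  have := congrArg (coeff m) h
  rw [coeff_homogeneousComponent, if_pos hmd, coeff_zero] at this
  exact mem_support_iff.mp hm this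

lemma MvPolynomial.coeff_aeval_affine {R : Type*} [CommRing R]
    (p : MvPolynomial (Fin 3) R) (q v : Fin 3 → R) :
    (aeval (fun i => Polynomial.C (q i) + Polynomial.C (v i) * Polynomial.X) p).coeff
      p.totalDegree = eval v (homogeneousComponent p.totalDegree p) := by
  have hl (i : Fin 3) : (Polynomial.C (q i) + Polynomial.C (v i) * Polynomial.X).natDegree ≤ 1 := by
    rw [add_comm]
    exact Polynomial.natDegree_linear_le
  have hlp (i : Fin 3) (n : ℕ) :
      ((Polynomial.C (q i) + Polynomial.C (v i) * Polynomial.X) ^ n).natDegree ≤ n := by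
    simpa using Polynomial.natDegree_pow_le_of_le n (hl i)
  have hlc (i : Fin 3) (n : ℕ) :
      ((Polynomial.C (q i) + Polynomial.C (v i) * Polynomial.X) ^ n).coeff n = v i ^ n := by
    simpa using Polynomial.coeff_pow_of_natDegree_le (m := n) (hl i)
  rw [homogeneousComponent_apply, aeval_def, eval₂_eq', Polynomial.finsetSum_coeff, map_sum,
    Finset.sum_filter]
  refine Finset.sum_congr rfl fun m hm => ?_
  have hmd : m.degree = m 0 + m 1 + m 2 := by
    rw [Finsupp.degree_eq_sum, Fin.sum_univ_three]
  rw [Fin.prod_univ_three, Polynomial.algebraMap_apply, Polynomial.coeff_C_mul]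
  split_ifs with h
  · rw [← h, hmd, Polynomial.coeff_mul_add_eq_of_natDegree_le
      (Polynomial.natDegree_mul_le_of_le (hlp _ _) (hlp _ _)) (hlp _ _),
      Polynomial.coeff_mul_add_eq_of_natDegree_le (hlp _ _) (hlp _ _), hlc, hlc, hlc,
      eval_monomial, Finsupp.prod_fintype _ _ (by simp), Fin.prod_univ_three]
    rfl
  · have hlt : m 0 + m 1 + m 2 < p.totalDegree := by
      rw [← hmd]
      exact lt_of_le_of_ne (le_totalDegree hm) h
    rw [Polynomial.coeff_eq_zero_of_natDegree_lt (lt_of_le_of_lt (Polynomial.natDegree_mul_le_of_le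
      (Polynomial.natDegree_mul_le_of_le (hlp _ _) (hlp _ _)) (hlp _ _)) hlt), mul_zero]

lemma MvPolynomial.coeff_aeval_affine_single {R : Type*} [CommRing R]
    (p : MvPolynomial (Fin 3) R) (q : Fin 3 → R) (M : Matrix (Fin 3) (Fin 3) R) :
    coeff (Finsupp.single 0 p.totalDegree) (aeval (fun i => C (q i) + ∑ j, C (M i j) * X j) p) =
      eval (fun i => M i 0) (homogeneousComponent p.totalDegree p) := by
  rw [← coeff_aeval_affine p q]
  let φ : MvPolynomial (Fin 3) R →ₐ[R] Polynomial R := aeval ![Polynomial.X, 0, 0]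
  have hφ (g : MvPolynomial (Fin 3) R) (n : ℕ) : coeff (Finsupp.single 0 n) g = (φ g).coeff n := by
    induction g using MvPolynomial.induction_on' with
    | add p q hp hq => simp [hp, hq]
    | monomial m a =>
      simp only [φ, aeval_monomial, coeff_monomial, Polynomial.algebraMap_apply,
        Finsupp.prod_fintype _ _ fun _ => pow_zero _, Fin.prod_univ_three]
      have hm : m = Finsupp.single 0 n ↔ m 0 = n ∧ m 1 = 0 ∧ m 2 = 0 := by
        simp [Finsupp.ext_iff, Fin.forall_fin_succ, Finsupp.single_apply]
      by_cases h1 : m 1 = 0 <;> by_cases h2 : m 2 = 0 <;>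
        simp [hm, h1, h2, Polynomial.coeff_X_pow, eq_comm]
  have hcomp : φ.comp (aeval fun i => C (q i) + ∑ j, C (M i j) * X j) =
      aeval fun i => Polynomial.C (q i) + Polynomial.C (M i 0) * Polynomial.X := by
    ext i : 1
    simp only [AlgHom.comp_apply, aeval_X]
    simp [φ, Fin.sum_univ_three, Polynomial.algebraMap_eq, ← algebraMap_eq]
  rw [hφ, ← hcomp, AlgHom.comp_apply]

end AffineSubstitution

section ChangeOfCoordinates

/-- The affine change of coordinates given by mutually inverse matrices and a new origin. -/
noncomputable def MvPolynomial.affineEquiv {R : Type*} [CommRing R] {n : Type*} [Fintype n]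
    [DecidableEq n] (M N : Matrix n n R) (hMN : M * N = 1) (hNM : N * M = 1) (q : n → R) :
    MvPolynomial n R ≃ₐ[R] MvPolynomial n R :=
  AlgEquiv.ofAlgHom (aeval fun i => C (q i) + ∑ j, C (M i j) * X j)
    (aeval fun j => ∑ i, C (N j i) * (X i - C (q i)))
    (by
      ext j : 1
      have h (k : n) : ∑ i, N j i * M i k = (1 : Matrix n n R) j k := by
        rw [← hNM, Matrix.mul_apply]
      simp only [AlgHom.comp_apply, aeval_X, AlgHom.id_apply, map_sum, map_mul, map_sub,
        ← algebraMap_eq, AlgHom.commutes, add_sub_cancel_left, Finset.mul_sum]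
      rw [Finset.sum_comm]
      simp only [← mul_assoc, ← map_mul, ← Finset.sum_mul, ← map_sum, h]
      simp [Matrix.one_apply])
    (by
      ext i : 1
      have h (k : n) : ∑ j, M i j * N j k = (1 : Matrix n n R) i k := by
        rw [← hMN, Matrix.mul_apply]
      simp only [AlgHom.comp_apply, aeval_X, AlgHom.id_apply, map_sum, map_mul, map_add,
        ← algebraMap_eq, AlgHom.commutes, Finset.mul_sum]
      rw [Finset.sum_comm]
      simp only [← mul_assoc, ← map_mul, ← Finset.sum_mul, ← map_sum, h]
      simp [Matrix.one_apply])

variable {K L : Type*} [Field K] [Field L] [Algebra K L]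

lemma regularDifferentials_of_frame {f : MvPolynomial (Fin 3) K} (hf : Irreducible f)
    (θ : MvPolynomial (Fin 3) K →ₐ[K] L)
    (hker : RingHom.ker (θ : MvPolynomial (Fin 3) K →+* L) = Ideal.span {f})
    (hθ : IsFractionRing θ.range L) {M N : Matrix (Fin 3) (Fin 3) K} (hMN : M * N = 1)
    (hNM : N * M = 1) (q : Fin 3 → K)
    (hc : eval (fun i => M i 0) (homogeneousComponent f.totalDegree f) ≠ 0)
    (hv : ∑ i, θ (pderiv i f) * algebraMap K L (M i 0) ≠ 0) {E : Derivation K L L}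
    (hE1 : ∑ i, algebraMap K L (N 1 i) * E (θ (X i)) = 0)
    (hE2 : ∑ i, algebraMap K L (N 2 i) * E (θ (X i)) =
      ∑ i, θ (pderiv i f) * algebraMap K L (M i 0))
    {ω : Ω[L⁄K]} (hω : ω ∈ regularDifferentials K L) :
    (∃ A : MvPolynomial (Fin 3) K, A.totalDegree ≤ f.totalDegree - 2 ∧
      θ A = E.liftKaehlerDifferential ω) ∧
    (q ∈ doubleCurveSet f → ∀ A, θ A = E.liftKaehlerDifferential ω → eval q A = 0) := by
  let τ := MvPolynomial.affineEquiv M N hMN hNM q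
  have hτX (i : Fin 3) : τ (X i) = C (q i) + ∑ j, C (M i j) * X j := aeval_X _ _
  have hτX' (j : Fin 3) : τ.symm (X j) = ∑ i, C (N j i) * (X i - C (q i)) := aeval_X _ _
  have hdeg (p : MvPolynomial (Fin 3) K) : (τ p).totalDegree ≤ p.totalDegree := by
    refine totalDegree_aeval_le (fun i => (totalDegree_add _ _).trans ?_) p
    rw [totalDegree_C]
    refine max_le zero_le (totalDegree_finsetSum_le fun j _ => (totalDegree_mul _ _).trans ?_)
    simp
  have hdeg' (p : MvPolynomial (Fin 3) K) : (τ.symm p).totalDegree ≤ p.totalDegree := by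
    refine totalDegree_aeval_le
      (fun i => totalDegree_finsetSum_le fun j _ => (totalDegree_mul _ _).trans ?_) p
    rw [totalDegree_C, zero_add]
    exact (totalDegree_sub_C_le _ _).trans (by simp)
  have hfdeg : (τ f).totalDegree = f.totalDegree :=
    le_antisymm (hdeg f) (by simpa using hdeg' (τ f))
  have hpderiv (j : Fin 3) (p : MvPolynomial (Fin 3) K) :
      pderiv j (τ p) = ∑ i, τ (pderiv i p) * C (M i j) := by
    have h := Derivation.apply_algHom (pderiv (R := K) j) (τ : _ →ₐ[K] _) p
    refine h.trans (Finset.sum_congr rfl fun i _ => ?_)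
    change τ _ * pderiv j (τ (X i)) = _
    rw [hτX]
    simp [pderiv_X, Pi.single_apply]
  have heval (p : MvPolynomial (Fin 3) K) : eval 0 (τ p) = eval q p := by
    suffices h : (aeval 0).comp (τ : _ →ₐ[K] MvPolynomial (Fin 3) K) = aeval q from
      DFunLike.congr_fun h p
    ext i
    change aeval 0 (τ (X i)) = _
    rw [hτX]
    simp
  let θ' : MvPolynomial (Fin 3) K →ₐ[K] L := θ.comp τ.symm
  have hθ'τ (p : MvPolynomial (Fin 3) K) : θ' (τ p) = θ p := by simp [θ']
  have hker' : RingHom.ker (θ' : MvPolynomial (Fin 3) K →+* L) = Ideal.span {τ f} := by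
    ext p
    rw [Ideal.mem_span_singleton, ← map_dvd_iff τ.symm, τ.symm_apply_apply,
      ← Ideal.mem_span_singleton, ← hker]
    rfl
  have hrange : θ'.range = θ.range := by
    ext x
    exact ⟨fun ⟨p, hp⟩ => ⟨τ.symm p, hp⟩, fun ⟨p, hp⟩ => ⟨τ p, (hθ'τ p).trans hp⟩⟩
  have hpderiv' : θ' (pderiv 0 (τ f)) = ∑ i, θ (pderiv i f) * algebraMap K L (M i 0) := by
    rw [hpderiv, map_sum]
    refine Finset.sum_congr rfl fun i _ => ?_
    rw [map_mul, hθ'τ, ← algebraMap_eq, AlgHom.commutes]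
  have hEθ' (j : Fin 3) : E (θ' (X j)) = ∑ i, algebraMap K L (N j i) * E (θ (X i)) := by
    have : θ' (X j) = ∑ i, N j i • (θ (X i) - algebraMap K L (q i)) := by
      change θ (τ.symm (X j)) = _
      rw [hτX', map_sum]
      refine Finset.sum_congr rfl fun i _ => ?_
      rw [map_mul, map_sub, ← algebraMap_eq, AlgHom.commutes, AlgHom.commutes, Algebra.smul_def]
    rw [this, map_sum]
    refine Finset.sum_congr rfl fun i _ => ?_
    rw [Derivation.map_smul, map_sub, Derivation.map_algebraMap, sub_zero, Algebra.smul_def]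
  obtain ⟨⟨A, hA, hAω⟩, hq⟩ := regularDifferentials_of_coeff_ne_zero (f := τ f)
    ((MulEquiv.irreducible_iff τ).mpr hf) θ' hker' (hrange ▸ hθ)
    (by
      rw [hfdeg]
      exact (coeff_aeval_affine_single f q M).trans_ne hc)
    (hpderiv' ▸ hv) (by rw [hEθ', hE1]) (by rw [hEθ', hE2, hpderiv']) hω
  refine ⟨⟨τ.symm A, (hdeg' A).trans (hfdeg ▸ hA), hAω⟩, fun ⟨h0, h1⟩ A hA => ?_⟩
  rw [← heval]
  refine hq ⟨by rw [heval, h0], fun j => ?_⟩ _ (by rw [hθ'τ, hA])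
  rw [hpderiv, map_sum]
  exact Finset.sum_eq_zero fun i _ => by rw [map_mul, heval, h1, zero_mul]

end ChangeOfCoordinates

section TangentDerivations

lemma MvPolynomial.exists_eval_ne_zero_eval_add_ne_zero {R σ : Type*} [CommRing R] [IsDomain R]
    [Infinite R] {h : MvPolynomial σ R} (hh : h ≠ 0) (u : σ → R) :
    ∃ v : σ → R, eval v h ≠ 0 ∧ eval (v + u) h ≠ 0 := by
  let t : MvPolynomial σ R := aeval (fun i => X i + C (u i)) h
  have ht (v : σ → R) : eval v t = eval (v + u) h := by
    suffices H : (aeval v).comp (aeval fun i => X i + C (u i)) = aeval (v + u) from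
      DFunLike.congr_fun H h
    ext i
    simp
  have ht0 : t ≠ 0 := by
    rintro h0
    refine hh (MvPolynomial.funext fun v => ?_)
    have := ht (v - u)
    rw [h0, sub_add_cancel] at this
    simpa using this.symm
  by_contra! H
  refine mul_ne_zero hh ht0 (MvPolynomial.funext fun v => ?_)
  rw [map_mul, ht, map_zero, mul_eq_zero]
  exact or_iff_not_imp_left.mpr (H v)

variable {K L : Type*} [Field K] [Field L] [Algebra K L]

lemma exists_adjoint_of_generic {f : MvPolynomial (Fin 3) K} (hf : Irreducible f)
    (θ : MvPolynomial (Fin 3) K →ₐ[K] L)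
    (hker : RingHom.ker (θ : MvPolynomial (Fin 3) K →+* L) = Ideal.span {f})
    (hθ : IsFractionRing θ.range L) {v w : Fin 3 → K}
    (hc : eval v (homogeneousComponent f.totalDegree f) ≠ 0)
    (hv : ∑ i, θ (pderiv i f) * algebraMap K L (v i) ≠ 0) {E : Derivation K L L}
    (hE : ∀ i, E (θ (X i)) = algebraMap K L (w i) * ∑ j, θ (pderiv j f) * algebraMap K L (v j) -
      algebraMap K L (v i) * ∑ j, θ (pderiv j f) * algebraMap K L (w j))
    {ω : Ω[L⁄K]} (hω : ω ∈ regularDifferentials K L) :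
    ∃ A : MvPolynomial (Fin 3) K, A.totalDegree ≤ f.totalDegree - 2 ∧ IsAdjointTo f A ∧
      θ A = E.liftKaehlerDifferential ω := by
  by_cases h : ∃ u : Fin 3 → K, (Matrix.of fun i => ![v i, u i, w i]).det ≠ 0
  · obtain ⟨u, hu⟩ := h
    set M : Matrix (Fin 3) (Fin 3) K := Matrix.of fun i => ![v i, u i, w i] with hM
    have hMN : M * M⁻¹ = 1 := Matrix.mul_nonsing_inv _ (isUnit_iff_ne_zero.mpr hu)
    have hNM : M⁻¹ * M = 1 := Matrix.nonsing_inv_mul _ (isUnit_iff_ne_zero.mpr hu)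
    have hNv (k : Fin 3) : ∑ i, algebraMap K L (M⁻¹ k i) * algebraMap K L (v i) =
        algebraMap K L ((1 : Matrix (Fin 3) (Fin 3) K) k 0) := by
      rw [← hNM, Matrix.mul_apply, map_sum]
      exact Finset.sum_congr rfl fun i _ => (map_mul _ _ _).symm
    have hNw (k : Fin 3) : ∑ i, algebraMap K L (M⁻¹ k i) * algebraMap K L (w i) =
        algebraMap K L ((1 : Matrix (Fin 3) (Fin 3) K) k 2) := by
      rw [← hNM, Matrix.mul_apply, map_sum]
      exact Finset.sum_congr rfl fun i _ => (map_mul _ _ _).symm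
    have hEN (k : Fin 3) : ∑ i, algebraMap K L (M⁻¹ k i) * E (θ (X i)) =
        algebraMap K L ((1 : Matrix (Fin 3) (Fin 3) K) k 2) *
          ∑ j, θ (pderiv j f) * algebraMap K L (v j) -
        algebraMap K L ((1 : Matrix (Fin 3) (Fin 3) K) k 0) *
          ∑ j, θ (pderiv j f) * algebraMap K L (w j) := by
      simp only [hE, mul_sub, ← mul_assoc, Finset.sum_sub_distrib, ← Finset.sum_mul, hNv, hNw]
    have key (q : Fin 3 → K) := regularDifferentials_of_frame hf θ hker hθ hMN hNM q hc hv
      (by rw [hEN]; simp) (by rw [hEN]; simp [hM]) hω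
    obtain ⟨A, hA, hAω⟩ := (key 0).1
    exact ⟨A, hA, fun q hq => (key q).2 hq A hAω, hAω⟩
  · push Not at h
    have h0 := h (Pi.single 0 1)
    have h1 := h (Pi.single 1 1)
    have h2 := h (Pi.single 2 1)
    simp only [Matrix.det_fin_three, Matrix.of_apply, Matrix.cons_val] at h0 h1 h2
    simp at h0 h1 h2
    have hE0 : E = 0 := Derivation.ext_of_isFractionRing_range θ hθ fun i => by
      rw [hE]
      have h01 := congrArg (algebraMap K L) h0
      have h11 := congrArg (algebraMap K L) h1
      have h21 := congrArg (algebraMap K L) h2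
      simp only [map_sub, map_add, map_neg, map_mul, map_zero] at h01 h11 h21
      fin_cases i <;>
        simp only [Fin.sum_univ_three, Fin.zero_eta, Fin.mk_one, Fin.reduceFinMk,
          Derivation.zero_apply]
      · linear_combination θ (pderiv 1 f) * h21 - θ (pderiv 2 f) * h11
      · linear_combination θ (pderiv 2 f) * h01 - θ (pderiv 0 f) * h21
      · linear_combination θ (pderiv 0 f) * h11 - θ (pderiv 1 f) * h01
    refine ⟨0, by simp, fun q _ => by simp, ?_⟩
    rw [map_zero, hE0, KaehlerDifferential.linearMap_ext_of_isFractionRing_range θ hθ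
      (u := Derivation.liftKaehlerDifferential 0) (v := 0) (by simp), LinearMap.zero_apply]

/-- Contracting a regular form with the tangent field `(v · ∇f) ∂_w - (w · ∇f) ∂_v` gives the
restriction of an adjoint polynomial. -/
lemma exists_adjoint_of_mem_regularDifferentials [Infinite K] {f : MvPolynomial (Fin 3) K}
    (hf : Irreducible f) (θ : MvPolynomial (Fin 3) K →ₐ[K] L)
    (hker : RingHom.ker (θ : MvPolynomial (Fin 3) K →+* L) = Ideal.span {f})
    (hθ : IsFractionRing θ.range L) (hz : θ (pderiv 2 f) ≠ 0) {v w : Fin 3 → K}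
    {E : Derivation K L L}
    (hE : ∀ i, E (θ (X i)) = algebraMap K L (w i) * ∑ j, θ (pderiv j f) * algebraMap K L (v j) -
      algebraMap K L (v i) * ∑ j, θ (pderiv j f) * algebraMap K L (w j))
    {ω : Ω[L⁄K]} (hω : ω ∈ regularDifferentials K L) :
    ∃ A : MvPolynomial (Fin 3) K, A.totalDegree ≤ f.totalDegree - 2 ∧ IsAdjointTo f A ∧
      θ A = E.liftKaehlerDifferential ω := by
  obtain ⟨l, hl⟩ : ∃ l : Module.Dual K L, l (θ (pderiv 2 f)) ≠ 0 := by
    by_contra! h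
    exact hz ((Module.forall_dual_apply_eq_zero_iff K _).mp h)
  let g : MvPolynomial (Fin 3) K := ∑ i, C (l (θ (pderiv i f))) * X i
  have hg (p : Fin 3 → K) : eval p g = l (∑ i, θ (pderiv i f) * algebraMap K L (p i)) := by
    simp only [g, map_sum, map_mul, eval_C, eval_X]
    refine Finset.sum_congr rfl fun i _ => ?_
    rw [mul_comm (θ _), ← Algebra.smul_def, map_smul, smul_eq_mul, mul_comm]
  have hg0 : g ≠ 0 := by
    intro h
    have := congrArg (eval (Pi.single 2 1)) h
    rw [hg] at this
    simp [Pi.single_apply, apply_ite (algebraMap K L), hl] at this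
  have hgv {p : Fin 3 → K}
      (hp : eval p (homogeneousComponent f.totalDegree f * g) ≠ 0) :
      eval p (homogeneousComponent f.totalDegree f) ≠ 0 ∧
        ∑ i, θ (pderiv i f) * algebraMap K L (p i) ≠ 0 := by
    rw [map_mul, hg, mul_ne_zero_iff] at hp
    exact ⟨hp.1, fun h => hp.2 (by rw [h, map_zero])⟩
  obtain ⟨p, hp, hpv⟩ := exists_eval_ne_zero_eval_add_ne_zero
    (mul_ne_zero (homogeneousComponent_totalDegree_ne_zero hf.ne_zero) hg0) v
  obtain ⟨E₁, hE₁⟩ := exists_derivation_of_sum_pderiv_eq_zero θ hker hθ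
    (fun i => algebraMap K L (w i) * ∑ j, θ (pderiv j f) * algebraMap K L (p j) -
      algebraMap K L (p i) * ∑ j, θ (pderiv j f) * algebraMap K L (w j))
    (by
      simp only [mul_sub, ← mul_assoc, Finset.sum_sub_distrib, ← Finset.sum_mul]
      ring)
  obtain ⟨A, hA, hAf, hAω⟩ := exists_adjoint_of_generic hf θ hker hθ (hgv hpv).1 (hgv hpv).2
    (E := E + E₁) (w := w) (fun i => by
      simp only [Derivation.add_apply, hE, hE₁, Pi.add_apply, map_add, mul_add,
        Finset.sum_add_distrib]
      ring) hω
  obtain ⟨B, hB, hBf, hBω⟩ := exists_adjoint_of_generic hf θ hker hθ (hgv hp).1 (hgv hp).2 hE₁ hω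
  refine ⟨A - B, (totalDegree_sub _ _).trans (max_le hA hB), fun q hq => ?_, ?_⟩
  · rw [map_sub, hAf q hq, hBf q hq, sub_zero]
  · rw [map_sub, hAω, hBω, ← LinearMap.sub_apply]
    congr 1
    exact (Derivation.liftKaehlerDifferential_unique _ _ (by ext; simp)).symm

end TangentDerivations

/-- **Picard's theorem.**  Every regular 1-form `ω` on `X` is the pull-back via the
normalization map of a rational 1-form `(A dy - B dx)/f_z` with `A = 0`, `B = 0`
adjoint surfaces of degree `d - 2` to `S`. -/
theorem picard_regular_one_forms
    {K : Type*} [Field K] [IsAlgClosed K] (d : ℕ)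
    (f : MvPolynomial (Fin 3) K)
    (hf_irr : Irreducible f) (hf_deg : f.totalDegree = d)
    -- `L` is the function field of `S` (hence of `X`): the fraction field of
    -- `K[x,y,z]/(f)`, presented by a `K`-algebra map `θ` with kernel `(f)`
    (L : Type*) [Field L] [Algebra K L]
    (θ : MvPolynomial (Fin 3) K →ₐ[K] L)
    (hθ_ker : RingHom.ker (θ : MvPolynomial (Fin 3) K →+* L) = Ideal.span {f})
    (hθ_frac : IsFractionRing θ.range L) :
    ∀ ω ∈ regularDifferentials K L,
      ∃ A B : MvPolynomial (Fin 3) K,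
        A.totalDegree ≤ d - 2 ∧ B.totalDegree ≤ d - 2 ∧
        IsAdjointTo f A ∧ IsAdjointTo f B ∧
        θ (pderiv 2 f) • ω
          = θ A • (KaehlerDifferential.D K L) (θ (X 1))
            - θ B • (KaehlerDifferential.D K L) (θ (X 0)) := by
  intro ω hω
  subst hf_deg
  by_cases hz : θ (pderiv 2 f) = 0
  · refine ⟨0, 0, by simp, by simp, fun q _ => by simp, fun q _ => by simp, by simp [hz]⟩
  have hK : Infinite K := IsAlgClosed.instInfinite
  have hθf : θ f = 0 := by
    have : f ∈ RingHom.ker (θ : MvPolynomial (Fin 3) K →+* L) :=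
      hθ_ker ▸ Ideal.mem_span_singleton_self f
    exact this
  have hdf := Derivation.apply_algHom (KaehlerDifferential.D K L) θ f
  rw [hθf, map_zero, Fin.sum_univ_three] at hdf
  obtain ⟨E₁, hE₁⟩ := exists_derivation_of_sum_pderiv_eq_zero θ hθ_ker hθ_frac
    ![0, θ (pderiv 2 f), -θ (pderiv 1 f)] (by simp [Fin.sum_univ_three]; ring)
  obtain ⟨E₂, hE₂⟩ := exists_derivation_of_sum_pderiv_eq_zero θ hθ_ker hθ_frac
    ![-θ (pderiv 2 f), 0, θ (pderiv 0 f)] (by simp [Fin.sum_univ_three]; ring)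
  obtain ⟨A, hA, hAf, hAω⟩ := exists_adjoint_of_mem_regularDifferentials hf_irr θ hθ_ker hθ_frac hz
    (v := Pi.single 2 1) (w := Pi.single 1 1) (E := E₁)
    (fun i => by fin_cases i <;> simp [hE₁, Fin.sum_univ_three]) hω
  obtain ⟨B, hB, hBf, hBω⟩ := exists_adjoint_of_mem_regularDifferentials hf_irr θ hθ_ker hθ_frac hz
    (v := Pi.single 0 1) (w := Pi.single 2 1) (E := E₂)
    (fun i => by fin_cases i <;> simp [hE₂, Fin.sum_univ_three]) hω
  refine ⟨A, B, hA, hB, hAf, hBf, ?_⟩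
  have key : θ (pderiv 2 f) • LinearMap.id =
      E₁.liftKaehlerDifferential.smulRight (KaehlerDifferential.D K L (θ (X 1))) -
        E₂.liftKaehlerDifferential.smulRight (KaehlerDifferential.D K L (θ (X 0))) := by
    refine KaehlerDifferential.linearMap_ext_of_isFractionRing_range θ hθ_frac fun i => ?_
    fin_cases i
    · simp [hE₁, hE₂]
    · simp [hE₁, hE₂]
    · simp [hE₁, hE₂, eq_neg_of_add_eq_zero_right hdf.symm]
      abel
  rw [hAω, hBω]
  exact DFunLike.congr_fun key ω
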